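/- arXiv:math/0111328 — 14 statements merged into one kernel-verified Lean document; each statement's English description precedes it below -/
import Mathlib

section
/- Let n ≥ 1 be an integer and let x, ρ, σ be real numbers. Let (a_{i,j})_{i,j≥0} be the doubly indexed sequence of real numbers determined by the initial conditions a_{i,0} = ρ^i and a_{0,i} = σ^i for all i ≥ 0, and the recurrence a_{i,j} = a_{i-1,j} + a_{i,j-1} + x·a_{i-1,j-1} for all i, j ≥ 1. Then det_{0≤i,j≤n-1}(a_{i,j}) = (1+x)^{binom(n-1,2)} · (x + ρ + σ - ρσ)^{n-1}. -/
/-- The array with all boundary entries equal to `1` that satisfies the weighted Delannoy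
recurrence with diagonal weight `x`. -/
def weightedDelannoy (x : ℝ) : ℕ → ℕ → ℝ
  | 0, _ => 1
  | _ + 1, 0 => 1
  | i + 1, j + 1 => weightedDelannoy x i (j + 1) + weightedDelannoy x (i + 1) j
      + x * weightedDelannoy x i j

theorem weightedDelannoy_zero_left (x : ℝ) (j : ℕ) : weightedDelannoy x 0 j = 1 := by
  rw [weightedDelannoy]

theorem weightedDelannoy_zero_right (x : ℝ) (i : ℕ) : weightedDelannoy x i 0 = 1 := by
  cases i <;> rw [weightedDelannoy]

theorem weightedDelannoy_succ_succ (x : ℝ) (i j : ℕ) :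
    weightedDelannoy x (i + 1) (j + 1) = weightedDelannoy x i (j + 1)
      + weightedDelannoy x (i + 1) j + x * weightedDelannoy x i j := by
  rw [weightedDelannoy]

/-- Removing the geometric boundary from an array satisfying the recurrence leaves a multiple of
the array with constant boundary. -/
theorem mixed_difference_eq_mul_weightedDelannoy (x ρ σ : ℝ) (a : ℕ → ℕ → ℝ)
    (hrow : ∀ i, a i 0 = ρ ^ i) (hcol : ∀ j, a 0 j = σ ^ j)
    (hrec : ∀ i j, a (i + 1) (j + 1) = a i (j + 1) + a (i + 1) j + x * a i j) (i j : ℕ) :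
    a (i + 1) (j + 1) - ρ * a i (j + 1) - σ * (a (i + 1) j - ρ * a i j) =
      (x + ρ + σ - ρ * σ) * weightedDelannoy x i j := by
  induction i generalizing j with
  | zero =>
    rw [weightedDelannoy_zero_left]
    induction j with
    | zero =>
      rw [hrec, hrow, hrow, hcol]
      ring
    | succ j ih =>
      have h₁ := hrec 0 (j + 1)
      have h₂ := hrec 0 j
      simp only [hcol] at *
      linear_combination ih + h₁ - σ * h₂
  | succ i ihi =>
    induction j with
    | zero =>
      have h := ihi 0
      have h₁ := hrec (i + 1) 0
      have h₂ := hrec i 0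
      simp only [hrow, weightedDelannoy_zero_right] at *
      linear_combination h + h₁ - ρ * h₂
    | succ j ihj =>
      rw [weightedDelannoy_succ_succ]
      linear_combination ihi (j + 1) + ihj + x * ihi j + hrec (i + 1) (j + 1)
        - ρ * hrec i (j + 1) - σ * hrec (i + 1) j + ρ * σ * hrec i j

/-- Eliminating the first row and column reduces the determinant to that of the array with
constant boundary. -/
theorem det_succ_eq_pow_mul_det_weightedDelannoy (n : ℕ) (x ρ σ : ℝ) (a : ℕ → ℕ → ℝ)
    (hrow : ∀ i, a i 0 = ρ ^ i) (hcol : ∀ j, a 0 j = σ ^ j)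
    (hrec : ∀ i j, a (i + 1) (j + 1) = a i (j + 1) + a (i + 1) j + x * a i j) :
    Matrix.det (Matrix.of fun i j : Fin (n + 1) => a i j) =
      (x + ρ + σ - ρ * σ) ^ n *
        Matrix.det (Matrix.of fun i j : Fin n => weightedDelannoy x i j) := by
  let r : ℕ → ℕ → ℝ := fun i j => if i = 0 then a 0 j else a i j - ρ * a (i - 1) j
  let b : ℕ → ℕ → ℝ := fun i j => if j = 0 then r i 0 else r i j - σ * r i (j - 1)
  have hr : Matrix.det (Matrix.of fun i j : Fin (n + 1) => a i j) =
      Matrix.det (Matrix.of fun i j : Fin (n + 1) => r i j) :=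
    Matrix.det_eq_of_forall_row_eq_smul_add_pred (fun _ => ρ) (by simp [r]) (by simp [r])
  have hb : Matrix.det (Matrix.of fun i j : Fin (n + 1) => r i j) =
      Matrix.det (Matrix.of fun i j : Fin (n + 1) => b i j) :=
    Matrix.det_eq_of_forall_col_eq_smul_add_pred (fun _ => σ) (by simp [b]) (by simp [b])
  have hminor : (Matrix.of fun i j : Fin (n + 1) => b i j).submatrix Fin.succ Fin.succ =
      (x + ρ + σ - ρ * σ) • Matrix.of fun i j : Fin n => weightedDelannoy x i j := by
    ext i j
    simpa [b, r] using mixed_difference_eq_mul_weightedDelannoy x ρ σ a hrow hcol hrec i j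
  rw [hr, hb, Matrix.det_succ_column_zero, Fin.sum_univ_succ, Finset.sum_eq_zero]
  · have hsucc : (Fin.succAbove 0 : Fin n → Fin (n + 1)) = Fin.succ := by
      ext i; simp
    rw [hsucc, hminor, Matrix.det_smul]
    simp [b, r, hrow]
  · intro i _
    simp [b, r, hrow, pow_succ']

theorem det_weightedDelannoy (n : ℕ) (x : ℝ) :
    Matrix.det (Matrix.of fun i j : Fin n => weightedDelannoy x i j) =
      (1 + x) ^ n.choose 2 := by
  induction n with
  | zero => simp
  | succ n ih =>
    rw [det_succ_eq_pow_mul_det_weightedDelannoy n x 1 1 (weightedDelannoy x)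
      (by simp [weightedDelannoy_zero_right]) (by simp [weightedDelannoy_zero_left])
      (weightedDelannoy_succ_succ x), ih, Nat.choose_succ_succ' n 1, Nat.choose_one_right, pow_add]
    ring

/-- Theorem 1 of Krattenthaler: determinant of the matrix whose entries satisfy the
Pascal-type recurrence `a i j = a (i-1) j + a i (j-1) + x * a (i-1) (j-1)` with
initial conditions `a i 0 = ρ^i` and `a 0 i = σ^i`. -/
theorem stmt_0 (n : ℕ) (hn : 1 ≤ n) (x ρ σ : ℝ) (a : ℕ → ℕ → ℝ)
    (ha_row : ∀ i : ℕ, a i 0 = ρ ^ i)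
    (ha_col : ∀ i : ℕ, a 0 i = σ ^ i)
    (ha_rec : ∀ i j : ℕ, 1 ≤ i → 1 ≤ j →
      a i j = a (i - 1) j + a i (j - 1) + x * a (i - 1) (j - 1)) :
    Matrix.det (Matrix.of fun i j : Fin n => a i.val j.val) =
      (1 + x) ^ ((n - 1).choose 2) * (x + ρ + σ - ρ * σ) ^ (n - 1) := by
  obtain ⟨m, rfl⟩ := Nat.exists_eq_add_of_le' hn
  rw [det_succ_eq_pow_mul_det_weightedDelannoy m x ρ σ a ha_row ha_col
    (fun i j => by simpa using ha_rec (i + 1) (j + 1) (by simp) (by simp)),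
    det_weightedDelannoy, Nat.add_sub_cancel, mul_comm]
end

section
/- Let n ≥ 1 be an integer and let x, ρ be real numbers. Let (a_{i,j})_{i,j≥0} be the doubly indexed sequence of real numbers determined by the initial conditions a_{0,0} = 0, a_{i,0} = ρ^{i-1} and a_{0,i} = -ρ^{i-1} for all i ≥ 1, and the recurrence a_{i,j} = a_{i-1,j} + a_{i,j-1} + x·a_{i-1,j-1} for all i, j ≥ 1. Then det_{0≤i,j≤2n-1}(a_{i,j}) = (1+x)^{2(n-1)^2} · (x + ρ)^{2n-2}. -/
/-- Coefficient of `u ^ i` in `(1 - u) / (1 - ρ * u) * (u / (1 - u)) ^ k`. -/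
def riordanCoeff (ρ : ℝ) : ℕ → ℕ → ℝ
  | 0, 0 => 1
  | 0, _ + 1 => 0
  | i + 1, 0 => ρ ^ (i + 1) - ρ ^ i
  | i + 1, k + 1 => riordanCoeff ρ i (k + 1) + riordanCoeff ρ i k

/-- Coefficient of `t ^ k` in `1 + (x + ρ) * t / (1 - (1 + x) * t)`. -/
def diagCoeff (x ρ : ℝ) : ℕ → ℝ
  | 0 => 1
  | k + 1 => (x + ρ) * (1 + x) ^ k

/-- Entries of the skew-symmetric tridiagonal matrix with subdiagonal `c`. -/
def skewTridiag (c : ℕ → ℝ) (i j : ℕ) : ℝ :=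
  (if i = j + 1 then c j else 0) - (if j = i + 1 then c i else 0)

lemma riordanCoeff_eq_zero_of_lt (ρ : ℝ) : ∀ {i k : ℕ}, i < k → riordanCoeff ρ i k = 0
  | 0, k + 1, _ => by simp [riordanCoeff]
  | i + 1, k + 1, h => by
    rw [riordanCoeff, riordanCoeff_eq_zero_of_lt ρ (by omega : i < k + 1),
      riordanCoeff_eq_zero_of_lt ρ (by omega : i < k), add_zero]

lemma riordanCoeff_self (ρ : ℝ) : ∀ i : ℕ, riordanCoeff ρ i i = 1
  | 0 => by simp [riordanCoeff]
  | i + 1 => by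
    rw [riordanCoeff, riordanCoeff_eq_zero_of_lt ρ (Nat.lt_succ_self i), riordanCoeff_self ρ i,
      zero_add]

lemma riordanCoeff_succ_one (ρ : ℝ) (i : ℕ) : riordanCoeff ρ (i + 1) 1 = ρ ^ i := by
  induction i with
  | zero => simp [riordanCoeff]
  | succ i ih =>
    rw [riordanCoeff, ih, riordanCoeff]
    ring

lemma riordanCoeff_succ_zero (ρ : ℝ) (i : ℕ) :
    riordanCoeff ρ (i + 1) 0 = (ρ - 1) * (riordanCoeff ρ i 1 + riordanCoeff ρ i 0) := by
  have h : riordanCoeff ρ i 1 + riordanCoeff ρ i 0 = ρ ^ i := by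
    rw [← riordanCoeff_succ_one, riordanCoeff]
  rw [h, riordanCoeff]
  ring

lemma det_riordanCoeff (ρ : ℝ) (N : ℕ) :
    (Matrix.of fun i j : Fin N => riordanCoeff ρ i j).det = 1 := by
  rw [Matrix.det_of_isLowerTriangular]
  · simp [riordanCoeff_self]
  · intro i j h
    exact riordanCoeff_eq_zero_of_lt ρ (by simpa using h)

/-- The form `∑ c k * (f (k + 1) * g k - f k * g (k + 1))` evaluated at rows of the Riordan array. -/
def skewSum (x ρ : ℝ) (N i j : ℕ) : ℝ :=
  ∑ k ∈ Finset.range N, diagCoeff x ρ k *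
    (riordanCoeff ρ i (k + 1) * riordanCoeff ρ j k - riordanCoeff ρ i k * riordanCoeff ρ j (k + 1))

lemma skewSum_succ_succ_add (x ρ : ℝ) (N i j : ℕ) :
    skewSum x ρ (N + 2) (i + 1) (j + 1) + (1 + x) * (diagCoeff x ρ (N + 1) *
        (riordanCoeff ρ i (N + 2) * riordanCoeff ρ j (N + 1) -
          riordanCoeff ρ i (N + 1) * riordanCoeff ρ j (N + 2))) =
      skewSum x ρ (N + 2) i (j + 1) + skewSum x ρ (N + 2) (i + 1) j +
        x * skewSum x ρ (N + 2) i j := by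
  induction N with
  | zero =>
    simp only [skewSum, Finset.sum_range_succ, Finset.sum_range_zero, riordanCoeff_succ_zero]
    simp only [diagCoeff, riordanCoeff, zero_add]
    ring
  | succ N ih =>
    rw [skewSum, skewSum, skewSum, skewSum] at ih ⊢
    simp only [Finset.sum_range_succ _ (N + 2), riordanCoeff, diagCoeff] at ih ⊢
    linear_combination ih

lemma skewSum_succ_succ (x ρ : ℝ) {N i j : ℕ} (hi : i + 1 < N) (hj : j + 1 < N) :
    skewSum x ρ N (i + 1) (j + 1) =
      skewSum x ρ N i (j + 1) + skewSum x ρ N (i + 1) j + x * skewSum x ρ N i j := by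
  obtain ⟨N, rfl⟩ : ∃ M, N = M + 2 := ⟨N - 2, by omega⟩
  rw [← skewSum_succ_succ_add, riordanCoeff_eq_zero_of_lt ρ (by omega : i < N + 2),
    riordanCoeff_eq_zero_of_lt ρ (by omega : j < N + 2)]
  ring

lemma skewSum_zero_right (x ρ : ℝ) {N : ℕ} (hN : 0 < N) (i : ℕ) :
    skewSum x ρ N i 0 = riordanCoeff ρ i 1 := by
  obtain ⟨N, rfl⟩ : ∃ M, N = M + 1 := ⟨N - 1, by omega⟩
  simp [skewSum, Finset.sum_range_succ', riordanCoeff, diagCoeff]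

lemma skewSum_swap (x ρ : ℝ) (N i j : ℕ) : skewSum x ρ N i j = -skewSum x ρ N j i := by
  rw [skewSum, skewSum, ← Finset.sum_neg_distrib]
  exact Finset.sum_congr rfl fun k _ => by ring

lemma eq_skewSum (x ρ : ℝ) (a : ℕ → ℕ → ℝ) (h00 : a 0 0 = 0)
    (ha_row : ∀ i : ℕ, 1 ≤ i → a i 0 = ρ ^ (i - 1))
    (ha_col : ∀ i : ℕ, 1 ≤ i → a 0 i = -ρ ^ (i - 1))
    (ha_rec : ∀ i j : ℕ, 1 ≤ i → 1 ≤ j →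
      a i j = a (i - 1) j + a i (j - 1) + x * a (i - 1) (j - 1)) {N : ℕ} :
    ∀ i j : ℕ, i < N → j < N → a i j = skewSum x ρ N i j
  | 0, 0, hi, _ => by
    rw [skewSum_zero_right x ρ hi, h00]
    simp [riordanCoeff]
  | i + 1, 0, _, hj => by
    rw [skewSum_zero_right x ρ hj, ha_row _ (by omega), riordanCoeff_succ_one]
    simp
  | 0, j + 1, hi, _ => by
    rw [skewSum_swap, skewSum_zero_right x ρ hi, ha_col _ (by omega), riordanCoeff_succ_one]
    simp
  | i + 1, j + 1, hi, hj => by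
    rw [ha_rec _ _ (by omega) (by omega), skewSum_succ_succ x ρ hi hj,
      ← eq_skewSum x ρ a h00 ha_row ha_col ha_rec i (j + 1) (by omega) hj,
      ← eq_skewSum x ρ a h00 ha_row ha_col ha_rec (i + 1) j hi (by omega),
      ← eq_skewSum x ρ a h00 ha_row ha_col ha_rec i j (by omega) (by omega)]
    simp

lemma riordanCoeff_mul_skewTridiag_mul_transpose (x ρ : ℝ) (N : ℕ) :
    (Matrix.of fun i j : Fin N => riordanCoeff ρ i j) *
        (Matrix.of fun i j : Fin N => skewTridiag (diagCoeff x ρ) i j) *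
        (Matrix.of fun i j : Fin N => riordanCoeff ρ i j).transpose =
      Matrix.of fun i j : Fin N => skewSum x ρ N i j := by
  have key (c : ℕ → ℝ) (i j : ℕ) (hi : i < N) :
      ∑ l ∈ Finset.range N, ∑ k ∈ Finset.range N,
        riordanCoeff ρ i k * (if k = l + 1 then c l else 0) * riordanCoeff ρ j l =
      ∑ l ∈ Finset.range N, c l * (riordanCoeff ρ i (l + 1) * riordanCoeff ρ j l) := by
    refine Finset.sum_congr rfl fun l _ => ?_
    simp only [mul_ite, ite_mul, mul_zero, zero_mul, Finset.sum_ite_eq', Finset.mem_range]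
    split_ifs with h
    · ring
    · rw [riordanCoeff_eq_zero_of_lt ρ (by omega : i < l + 1)]
      ring
  ext i j
  have h₁ := key (diagCoeff x ρ) i j i.2
  have h₂ := key (diagCoeff x ρ) j i j.2
  rw [Finset.sum_comm] at h₁
  simp only [Matrix.mul_apply, Matrix.of_apply, Matrix.transpose_apply, Finset.sum_mul]
  rw [Finset.sum_comm, skewSum]
  simp only [mul_sub, Finset.sum_sub_distrib]
  have h₃ : ∑ l ∈ Finset.range N, diagCoeff x ρ l *
      (riordanCoeff ρ i l * riordanCoeff ρ j (l + 1)) = ∑ l ∈ Finset.range N, diagCoeff x ρ l *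
      (riordanCoeff ρ j (l + 1) * riordanCoeff ρ i l) :=
    Finset.sum_congr rfl fun l _ => by ring
  rw [h₃, ← h₁, ← h₂, ← Finset.sum_sub_distrib, Finset.sum_range]
  refine Finset.sum_congr rfl fun k _ => ?_
  rw [← Finset.sum_sub_distrib, Finset.sum_range]
  refine Finset.sum_congr rfl fun l _ => ?_
  rw [skewTridiag]
  ring

lemma det_skewTridiag_add_two (c : ℕ → ℝ) (m : ℕ) :
    (Matrix.of fun i j : Fin (m + 2) => skewTridiag c i j).det =
      c 0 ^ 2 * (Matrix.of fun i j : Fin m => skewTridiag (fun k => c (k + 2)) i j).det := by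
  have h (k : ℕ) : skewTridiag c 0 (k + 2) = 0 := by simp [skewTridiag]
  have h' (k : ℕ) : skewTridiag c (k + 2) 0 = 0 := by simp [skewTridiag]
  have minor : ((Matrix.of fun i j : Fin (m + 2) => skewTridiag c i j).submatrix Fin.succ
      (Fin.succ 0 : Fin (m + 2)).succAbove).det =
      c 0 * (Matrix.of fun i j : Fin m => skewTridiag (fun k => c (k + 2)) i j).det := by
    rw [Matrix.det_succ_column_zero, Fin.sum_univ_succ, Finset.sum_eq_zero fun i _ => by simp [h']]
    have h₂ : (((Matrix.of fun i j : Fin (m + 2) => skewTridiag c i j).submatrix Fin.succ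
        (Fin.succ 0 : Fin (m + 2)).succAbove).submatrix (Fin.succAbove 0) Fin.succ) =
        Matrix.of fun i j : Fin m => skewTridiag (fun k => c (k + 2)) i j := by
      ext i j
      simp [skewTridiag]
    rw [h₂]
    simp [skewTridiag]
  rw [Matrix.det_succ_row_zero, Fin.sum_univ_succ, Fin.sum_univ_succ, minor,
    Finset.sum_eq_zero fun i _ => by simp [h]]
  simp [skewTridiag]
  ring

lemma det_skewTridiag (c : ℕ → ℝ) (n : ℕ) :
    (Matrix.of fun i j : Fin (2 * n) => skewTridiag c i j).det =
      ∏ k ∈ Finset.range n, c (2 * k) ^ 2 := by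
  induction n generalizing c with
  | zero => simp
  | succ n ih =>
    rw [show 2 * (n + 1) = 2 * n + 2 by ring, det_skewTridiag_add_two, ih,
      Finset.prod_range_succ', mul_comm]
    rfl

lemma prod_diagCoeff (x ρ : ℝ) (m : ℕ) :
    ∏ k ∈ Finset.range (m + 1), diagCoeff x ρ (2 * k) ^ 2 =
      (1 + x) ^ (2 * m ^ 2) * (x + ρ) ^ (2 * m) := by
  induction m with
  | zero => simp [diagCoeff]
  | succ m ih =>
    rw [Finset.prod_range_succ, ih, show 2 * (m + 1) = 2 * m + 1 + 1 by ring, diagCoeff]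
    ring


/-- Theorem 2 of Krattenthaler: determinant of the `2n × 2n` matrix whose entries satisfy
`a i j = a (i-1) j + a i (j-1) + x * a (i-1) (j-1)` with initial conditions `a 0 0 = 0`,
`a i 0 = ρ^(i-1)` and `a 0 i = -ρ^(i-1)` for `i ≥ 1`. -/
theorem stmt_1 (n : ℕ) (hn : 1 ≤ n) (x ρ : ℝ) (a : ℕ → ℕ → ℝ)
    (h00 : a 0 0 = 0)
    (ha_row : ∀ i : ℕ, 1 ≤ i → a i 0 = ρ ^ (i - 1))
    (ha_col : ∀ i : ℕ, 1 ≤ i → a 0 i = -ρ ^ (i - 1))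
    (ha_rec : ∀ i j : ℕ, 1 ≤ i → 1 ≤ j →
      a i j = a (i - 1) j + a i (j - 1) + x * a (i - 1) (j - 1)) :
    Matrix.det (Matrix.of fun i j : Fin (2 * n) => a i.val j.val) =
      (1 + x) ^ (2 * (n - 1) ^ 2) * (x + ρ) ^ (2 * n - 2) := by
  obtain ⟨m, rfl⟩ : ∃ m, n = m + 1 := ⟨n - 1, by omega⟩
  have h : (Matrix.of fun i j : Fin (2 * (m + 1)) => a i.val j.val) =
      Matrix.of fun i j : Fin (2 * (m + 1)) => skewSum x ρ (2 * (m + 1)) i j := by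
    ext i j
    exact eq_skewSum x ρ a h00 ha_row ha_col ha_rec i j i.2 j.2
  rw [h, ← riordanCoeff_mul_skewTridiag_mul_transpose, Matrix.det_mul, Matrix.det_mul,
    Matrix.det_transpose, det_riordanCoeff, det_skewTridiag, prod_diagCoeff, one_mul, mul_one]
  rfl
end

section
/- Let n ≥ 1 be an integer and let x be a real number. Let (a_{i,j})_{i,j≥0} be the doubly indexed sequence of real numbers determined by the initial conditions a_{i,0} = i and a_{0,i} = -i for all i ≥ 0, and the recurrence a_{i,j} = a_{i-1,j} + a_{i,j-1} + x·a_{i-1,j-1} for all i, j ≥ 1. Then det_{0≤i,j≤2n-1}(a_{i,j}) = (1+x)^{2n(n-1)}. -/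
/-- The skew-symmetric tridiagonal matrix with subdiagonal `w` and superdiagonal `-w`. -/
def skewTridiagonal (m : ℕ) (w : ℕ → ℝ) : Matrix (Fin m) (Fin m) ℝ :=
  Matrix.of fun k l => (if k.val = l.val + 1 then w l else 0) - if l.val = k.val + 1 then w k else 0

theorem det_skewTridiagonal_add_two (m : ℕ) (w : ℕ → ℝ) :
    (skewTridiagonal (m + 2) w).det = w 0 ^ 2 * (skewTridiagonal m fun k => w (k + 2)).det := by
  rw [Matrix.det_succ_row_zero, Finset.sum_eq_single (1 : Fin (m + 2))]
  · rw [Matrix.det_succ_column_zero, Finset.sum_eq_single (0 : Fin (m + 1))]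
    · have h : (((skewTridiagonal (m + 2) w).submatrix Fin.succ
          (Fin.succAbove 1)).submatrix (Fin.succAbove 0) Fin.succ) =
          skewTridiagonal m fun k => w (k + 2) := by
        ext k l
        have hl : (Fin.succAbove (1 : Fin (m + 2)) l.succ) = l.succ.succ := by
          rw [← Fin.succ_zero_eq_one, Fin.succ_succAbove_succ, Fin.zero_succAbove]
        simp [skewTridiagonal, hl]
      rw [h]
      simp [skewTridiagonal]
      ring
    · intro k _ hk
      have hk' : k.val ≠ 0 := fun h => hk (Fin.ext h)
      simp [skewTridiagonal, hk']
    · simp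
  · intro l _ hl
    have hl' : l.val ≠ 1 := fun h => hl (Fin.ext h)
    simp [skewTridiagonal, hl']
  · simp

theorem det_skewTridiagonal_two_mul (n : ℕ) (w : ℕ → ℝ) :
    (skewTridiagonal (2 * n) w).det = ∏ k ∈ Finset.range n, w (2 * k) ^ 2 := by
  induction n generalizing w with
  | zero => simp
  | succ n ih =>
    rw [show 2 * (n + 1) = 2 * n + 2 by ring, det_skewTridiagonal_add_two, ih,
      Finset.prod_range_succ']
    simp only [mul_add, mul_one, mul_zero]
    ring

/-- The lower unitriangular Pascal matrix. -/
def pascalMatrix (m : ℕ) : Matrix (Fin m) (Fin m) ℝ :=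
  Matrix.of fun i k => (i.val.choose k.val : ℝ)

theorem det_pascalMatrix (m : ℕ) : (pascalMatrix m).det = 1 := by
  rw [Matrix.det_of_isLowerTriangular]
  · simp [pascalMatrix]
  · intro i j hij
    have : i.val < j.val := hij
    simp [pascalMatrix, Nat.choose_eq_zero_of_lt this]

/-- The alternating binomial sum that is the `(i, j)` entry of
`pascalMatrix * skewTridiagonal * pascalMatrixᵀ`. -/
noncomputable def binomSkewSum (w : ℕ → ℝ) (N i j : ℕ) : ℝ :=
  ∑ k ∈ Finset.range N,
    w k * (i.choose (k + 1) * j.choose k - i.choose k * j.choose (k + 1))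

theorem binomSkewSum_succ_of_le (w : ℕ → ℝ) {N i j : ℕ} (hi : i ≤ N) (hj : j ≤ N) :
    binomSkewSum w (N + 1) i j = binomSkewSum w N i j := by
  rw [binomSkewSum, Finset.sum_range_succ, Nat.choose_eq_zero_of_lt (Nat.lt_succ_of_le hi),
    Nat.choose_eq_zero_of_lt (Nat.lt_succ_of_le hj)]
  simp [binomSkewSum]

theorem binomSkewSum_pow_mixed_difference (q : ℝ) (N i j : ℕ) :
    binomSkewSum (q ^ ·) (N + 1) (i + 1) (j + 1) - binomSkewSum (q ^ ·) (N + 1) i (j + 1) -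
      binomSkewSum (q ^ ·) (N + 1) (i + 1) j + binomSkewSum (q ^ ·) (N + 1) i j =
      q * binomSkewSum (q ^ ·) N i j := by
  simp only [binomSkewSum, ← Finset.sum_sub_distrib, ← Finset.sum_add_distrib, Finset.mul_sum]
  rw [Finset.sum_range_succ', add_eq_left.mpr]
  · refine Finset.sum_congr rfl fun k _ => ?_
    simp only [Nat.choose_succ_succ']
    push_cast
    ring
  · simp
    ring

theorem eq_binomSkewSum_of_rec (x : ℝ) (a : ℕ → ℕ → ℝ)
    (ha_row : ∀ i : ℕ, a i 0 = (i : ℝ)) (ha_col : ∀ i : ℕ, a 0 i = -(i : ℝ))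
    (ha_rec : ∀ i j : ℕ, 1 ≤ i → 1 ≤ j →
      a i j = a (i - 1) j + a i (j - 1) + x * a (i - 1) (j - 1))
    {N : ℕ} (hN : 1 ≤ N) (i j : ℕ) (hi : i ≤ N) (hj : j ≤ N) :
    a i j = binomSkewSum ((1 + x) ^ ·) N i j := by
  induction i generalizing j with
  | zero =>
    obtain ⟨M, rfl⟩ := Nat.exists_eq_add_of_le' hN
    rw [ha_col, binomSkewSum, Finset.sum_range_succ']
    simp
  | succ i ihi =>
    induction j with
    | zero =>
      obtain ⟨M, rfl⟩ := Nat.exists_eq_add_of_le' hN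
      rw [ha_row, binomSkewSum, Finset.sum_range_succ']
      simp
    | succ j ihj =>
      have h := binomSkewSum_pow_mixed_difference (1 + x) N i j
      rw [binomSkewSum_succ_of_le _ hi hj, binomSkewSum_succ_of_le _ (by omega) hj,
        binomSkewSum_succ_of_le _ hi (by omega),
        binomSkewSum_succ_of_le _ (by omega) (by omega)] at h
      rw [ha_rec _ _ (by omega) (by omega), Nat.add_sub_cancel, Nat.add_sub_cancel,
        ihi _ (by omega) hj, ihj (by omega), ihi _ (by omega) (by omega)]
      linarith

theorem sum_ite_eq_add_one_choose (m i l : ℕ) (hi : i < m) (c : ℝ) :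
    ∑ k : Fin m, (i.choose k.val : ℝ) * (if k.val = l + 1 then c else 0) =
      i.choose (l + 1) * c := by
  rw [Fin.sum_univ_eq_sum_range (fun k => (i.choose k : ℝ) * (if k = l + 1 then c else 0))]
  simp only [mul_ite, mul_zero, Finset.sum_ite_eq', Finset.mem_range]
  split_ifs with h
  · rfl
  · rw [Nat.choose_eq_zero_of_lt (by omega)]
    simp

theorem pascalMatrix_mul_skewTridiagonal_mul_transpose (m : ℕ) (w : ℕ → ℝ) :
    pascalMatrix m * skewTridiagonal m w * (pascalMatrix m).transpose =
      Matrix.of fun i j : Fin m => binomSkewSum w m i.val j.val := by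
  ext i j
  have h (i j : Fin m) : ∑ l : Fin m, ∑ k : Fin m, (i.val.choose k.val : ℝ) *
      (if k.val = l.val + 1 then w l else 0) * j.val.choose l.val =
      ∑ l ∈ Finset.range m, w l * (i.val.choose (l + 1) * j.val.choose l) := by
    rw [← Fin.sum_univ_eq_sum_range
      (fun l => w l * (i.val.choose (l + 1) * j.val.choose l : ℝ))]
    refine Finset.sum_congr rfl fun l _ => ?_
    rw [← Finset.sum_mul, sum_ite_eq_add_one_choose m i l i.isLt]
    ring
  simp only [Matrix.mul_apply, Matrix.transpose_apply, pascalMatrix, skewTridiagonal,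
    Matrix.of_apply, binomSkewSum, mul_sub, sub_mul, Finset.sum_mul, Finset.sum_sub_distrib]
  rw [h i j]
  congr 1
  rw [Finset.sum_comm]
  trans ∑ l ∈ Finset.range m, w l * (j.val.choose (l + 1) * i.val.choose l : ℝ)
  · rw [← h j i]
    exact Finset.sum_congr rfl fun _ _ => Finset.sum_congr rfl fun _ _ => by ring
  · exact Finset.sum_congr rfl fun _ _ => by ring


/-- Theorem 3 of Krattenthaler: determinant of the `2n × 2n` matrix whose entries satisfy
`a i j = a (i-1) j + a i (j-1) + x * a (i-1) (j-1)` with initial conditions `a i 0 = i`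
and `a 0 i = -i`. -/
theorem stmt_2 (n : ℕ) (hn : 1 ≤ n) (x : ℝ) (a : ℕ → ℕ → ℝ)
    (ha_row : ∀ i : ℕ, a i 0 = (i : ℝ))
    (ha_col : ∀ i : ℕ, a 0 i = -(i : ℝ))
    (ha_rec : ∀ i j : ℕ, 1 ≤ i → 1 ≤ j →
      a i j = a (i - 1) j + a i (j - 1) + x * a (i - 1) (j - 1)) :
    Matrix.det (Matrix.of fun i j : Fin (2 * n) => a i.val j.val) =
      (1 + x) ^ (2 * n * (n - 1)) := by
  have hA : (Matrix.of fun i j : Fin (2 * n) => a i.val j.val) =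
      pascalMatrix (2 * n) * skewTridiagonal (2 * n) ((1 + x) ^ ·) *
        (pascalMatrix (2 * n)).transpose := by
    rw [pascalMatrix_mul_skewTridiagonal_mul_transpose]
    ext i j
    exact eq_binomSkewSum_of_rec x a ha_row ha_col ha_rec (by omega) _ _ i.isLt.le j.isLt.le
  rw [hA, Matrix.det_mul, Matrix.det_mul, Matrix.det_transpose, det_pascalMatrix,
    det_skewTridiagonal_two_mul, one_mul, mul_one]
  simp only [← pow_mul]
  rw [Finset.prod_pow_eq_pow_sum, ← Finset.sum_mul, ← Finset.mul_sum, mul_assoc 2,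
    Finset.sum_range_id_mul_two, mul_assoc]
end

section
/- Let x be a real number and let (a_{i,j})_{i,j≥0} be the doubly indexed sequence of real numbers determined by the initial conditions a_{i,0} = i and a_{0,i} = -i for all i ≥ 0, and the recurrence a_{i,j} = a_{i-1,j} + a_{i,j-1} + x·a_{i-1,j-1} for all i, j ≥ 1. Then for all i, j ≥ 0, a_{i,j} = Σ_{ℓ=0}^{∞} ( binom(i,ℓ+1)·binom(j,ℓ) − binom(i,ℓ)·binom(j,ℓ+1) ) · (x+1)^ℓ, where the sum is finite since all terms with ℓ ≥ max(i,j) vanish. -/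
/-- The summand of the closed formula satisfies a mixed second difference recurrence that shifts
the summation index. -/
theorem choose_skew_mixed_difference (i j l : ℕ) :
    (((i + 1).choose (l + 2) : ℝ) * ((j + 1).choose (l + 1) : ℝ) -
        ((i + 1).choose (l + 1) : ℝ) * ((j + 1).choose (l + 2) : ℝ)) =
      ((i.choose (l + 2) : ℝ) * ((j + 1).choose (l + 1) : ℝ) -
        (i.choose (l + 1) : ℝ) * ((j + 1).choose (l + 2) : ℝ)) +
      (((i + 1).choose (l + 2) : ℝ) * (j.choose (l + 1) : ℝ) -
        ((i + 1).choose (l + 1) : ℝ) * (j.choose (l + 2) : ℝ)) -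
      ((i.choose (l + 2) : ℝ) * (j.choose (l + 1) : ℝ) -
        (i.choose (l + 1) : ℝ) * (j.choose (l + 2) : ℝ)) +
      ((i.choose (l + 1) : ℝ) * (j.choose l : ℝ) -
        (i.choose l : ℝ) * (j.choose (l + 1) : ℝ)) := by
  simp only [Nat.choose_succ_succ' i, Nat.choose_succ_succ' j, Nat.cast_add]
  ring

/-- The truncated sum `Σ_{l < N} (C(i,l+1)C(j,l) - C(i,l)C(j,l+1)) y^l`. -/
noncomputable def chooseSkewSum (y : ℝ) (N i j : ℕ) : ℝ :=
  ∑ l ∈ Finset.range N,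
    ((i.choose (l + 1) : ℝ) * (j.choose l : ℝ) -
      (i.choose l : ℝ) * (j.choose (l + 1) : ℝ)) * y ^ l

theorem chooseSkewSum_swap (y : ℝ) (N i j : ℕ) :
    chooseSkewSum y N i j = -chooseSkewSum y N j i := by
  rw [chooseSkewSum, chooseSkewSum, ← Finset.sum_neg_distrib]
  exact Finset.sum_congr rfl fun l _ => by ring

theorem chooseSkewSum_zero_right (y : ℝ) {N i : ℕ} (h : i ≤ N) :
    chooseSkewSum y N i 0 = i := by
  cases N with
  | zero => simp [chooseSkewSum, Nat.le_zero.mp h]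
  | succ N => simp [chooseSkewSum, Finset.sum_range_succ']

theorem chooseSkewSum_succ_succ (y : ℝ) (N i j : ℕ) :
    chooseSkewSum y (N + 1) (i + 1) (j + 1) =
      chooseSkewSum y (N + 1) i (j + 1) + chooseSkewSum y (N + 1) (i + 1) j -
        chooseSkewSum y (N + 1) i j + y * chooseSkewSum y N i j := by
  have h (T A B C D : ℕ → ℝ) (hT : ∀ l, T (l + 1) = A (l + 1) + B (l + 1) - C (l + 1) + D l)
      (h₀ : T 0 = A 0 + B 0 - C 0) :
      ∑ l ∈ Finset.range (N + 1), T l * y ^ l =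
        ∑ l ∈ Finset.range (N + 1), A l * y ^ l + ∑ l ∈ Finset.range (N + 1), B l * y ^ l -
          ∑ l ∈ Finset.range (N + 1), C l * y ^ l + y * ∑ l ∈ Finset.range N, D l * y ^ l := by
    rw [← Finset.sum_add_distrib, ← Finset.sum_sub_distrib, Finset.sum_range_succ',
      Finset.sum_range_succ' _ N, Finset.mul_sum, h₀, add_right_comm, ← Finset.sum_add_distrib]
    congr 1
    · exact Finset.sum_congr rfl fun l _ => by rw [hT]; ring
    · ring
  refine h _ _ _ _ _ (choose_skew_mixed_difference i j) ?_
  simp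
  ring

/-- The closed formula for the entries in Theorem 3 of Krattenthaler:
`a i j = Σ_ℓ (C(i,ℓ+1)C(j,ℓ) - C(i,ℓ)C(j,ℓ+1)) (x+1)^ℓ`; the sum is finite, all terms
with `ℓ ≥ max i j` vanishing, so it is written as a sum over `ℓ < max i j`. -/
theorem stmt_3 (x : ℝ) (a : ℕ → ℕ → ℝ)
    (ha_row : ∀ i : ℕ, a i 0 = (i : ℝ))
    (ha_col : ∀ i : ℕ, a 0 i = -(i : ℝ))
    (ha_rec : ∀ i j : ℕ, 1 ≤ i → 1 ≤ j →
      a i j = a (i - 1) j + a i (j - 1) + x * a (i - 1) (j - 1)) :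
    ∀ i j : ℕ, a i j = ∑ ℓ ∈ Finset.range (max i j),
      ((i.choose (ℓ + 1) : ℝ) * (j.choose ℓ : ℝ) -
        (i.choose ℓ : ℝ) * (j.choose (ℓ + 1) : ℝ)) * (x + 1) ^ ℓ := by
  have key : ∀ i j N : ℕ, max i j ≤ N → a i j = chooseSkewSum (x + 1) N i j := by
    intro i
    induction i with
    | zero =>
      intro j N h
      rw [ha_col, chooseSkewSum_swap, chooseSkewSum_zero_right _ (le_of_max_le_right h)]
    | succ i ihi =>
      intro j
      induction j with
      | zero =>
        intro N h
        rw [ha_row, chooseSkewSum_zero_right _ (le_of_max_le_left h)]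
      | succ j ihj =>
        intro N h
        obtain ⟨M, rfl⟩ : ∃ M, N = M + 1 := ⟨N - 1, by omega⟩
        have hM : a i j = chooseSkewSum (x + 1) M i j := ihi j M (by omega)
        have hM' : a i j = chooseSkewSum (x + 1) (M + 1) i j := ihi j (M + 1) (by omega)
        rw [ha_rec (i + 1) (j + 1) (by omega) (by omega), chooseSkewSum_succ_succ, ← hM, ← hM',
          Nat.add_sub_cancel, Nat.add_sub_cancel, ihi (j + 1) (M + 1) (by omega),
          ihj (M + 1) (by omega)]
        ring
  exact fun i j => key i j _ le_rfl
end

section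
/- Let n ≥ 1 and a ≥ 0 be integers. Then det_{0≤i,j≤n-1}( binom(2i+2j+a, i) − binom(2i+2j+a, i−1) ) = 2^{binom(n,2)}, where binom(m, i−1) is interpreted as 0 when i = 0. -/
open Polynomial in
/-- The `i`-th coefficients of `f i * (1 + X * g) ^ j` form a lower triangular matrix times the
unitriangular matrix of binomial coefficients. -/
theorem Matrix.det_coeff_mul_one_add_X_mul_pow {R : Type*} [CommRing R] (n : ℕ) (f : ℕ → R[X])
    (g : R[X]) :
    Matrix.det (Matrix.of fun i j : Fin n => (f i * (1 + X * g) ^ (j : ℕ)).coeff i) =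
      ∏ i : Fin n, (f i).coeff 0 * g.coeff 0 ^ (i : ℕ) := by
  let L : Matrix (Fin n) (Fin n) R := Matrix.of fun i k => (f i * (X * g) ^ (k : ℕ)).coeff i
  let U : Matrix (Fin n) (Fin n) R := Matrix.of fun k j => ((j : ℕ).choose k : R)
  have coeff_eq (i k : ℕ) : (f i * (X * g) ^ k).coeff i =
      if k ≤ i then (f i * g ^ k).coeff (i - k) else 0 := by
    rw [mul_pow, mul_left_comm, coeff_X_pow_mul']
  have hLU : (Matrix.of fun i j : Fin n => (f i * (1 + X * g) ^ (j : ℕ)).coeff i) = L * U := by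
    ext i j
    simp only [L, U, Matrix.mul_apply, Matrix.of_apply]
    have hsum := Fin.sum_univ_eq_sum_range
      (fun k : ℕ => coeff (f i * (X * g) ^ k) i * ((j : ℕ).choose k : R)) n
    rw [hsum, add_comm 1, add_pow,
      Finset.mul_sum, finsetSum_coeff]
    simp only [one_pow, mul_one, ← mul_assoc, coeff_mul_natCast]
    refine Finset.sum_subset (Finset.range_subset_range.2 j.isLt) fun k _ hk => ?_
    rw [Nat.choose_eq_zero_of_lt (by simpa using hk), Nat.cast_zero, mul_zero]
  have hL : L.det = ∏ i : Fin n, (f i).coeff 0 * g.coeff 0 ^ (i : ℕ) := by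
    rw [Matrix.det_of_isLowerTriangular]
    · refine Finset.prod_congr rfl fun i _ => ?_
      simp [L, coeff_eq, coeff_zero_eq_eval_zero]
    · intro i k hik
      have hik : i < k := hik
      simp [L, coeff_eq, hik]
  have hU : U.det = 1 := by
    rw [Matrix.det_of_isUpperTriangular]
    · simp [U]
    · intro k j hjk
      have hjk : j < k := hjk
      simp [U, Nat.choose_eq_zero_of_lt (show (j : ℕ) < k from hjk)]
  rw [hLU, Matrix.det_mul, hL, hU, mul_one]

open Polynomial in
theorem Polynomial.coeff_one_sub_X_mul_one_add_X_pow {R : Type*} [Ring R] (m i : ℕ) :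
    ((1 - X) * (1 + X : R[X]) ^ m).coeff i =
      (m.choose i : R) - if i = 0 then 0 else (m.choose (i - 1) : R) := by
  rw [sub_mul, one_mul, coeff_sub, coeff_one_add_X_pow]
  cases i with
  | zero => simp
  | succ i => simp [coeff_X_mul, coeff_one_add_X_pow]

open Polynomial in
/-- Theorem 4 of Krattenthaler:
`det (C(2i+2j+a, i) - C(2i+2j+a, i-1)) = 2^(n choose 2)`,
where `C(m, i-1)` is interpreted as `0` when `i = 0`. -/
theorem stmt_4 (n a : ℕ) (hn : 1 ≤ n) :
    Matrix.det (Matrix.of fun i j : Fin n =>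
      ((Nat.choose (2 * i.val + 2 * j.val + a) i.val : ℤ) -
        if i.val = 0 then 0
        else (Nat.choose (2 * i.val + 2 * j.val + a) (i.val - 1) : ℤ))) =
      2 ^ n.choose 2 := by
  have key := Matrix.det_coeff_mul_one_add_X_mul_pow n
    (fun i => (1 - X) * (1 + X : ℤ[X]) ^ (2 * i + a)) (2 + X)
  have hprod : ∏ i : Fin n, (2 : ℤ) ^ (i : ℕ) = 2 ^ n.choose 2 := by
    rw [Fin.prod_univ_eq_prod_range (fun i => (2 : ℤ) ^ i) n, Finset.prod_pow_eq_pow_sum,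
      Finset.sum_range_id, Nat.choose_two_right]
  rw [← hprod]
  convert key using 1
  · congr 1
    ext i j
    simp only [Matrix.of_apply]
    rw [← Polynomial.coeff_one_sub_X_mul_one_add_X_pow]
    rw [show (1 + X * (2 + X) : ℤ[X]) = (1 + X) ^ 2 by ring, ← pow_mul]
    congr 1
    ring
  · simp [Polynomial.coeff_zero_eq_eval_zero]
end

section
/- Let n ≥ 1 and a ≥ 0 be integers. Then, as an identity of rational numbers, det_{0≤i,j≤n-1}( binom(2i+2j+a, i+1) − binom(2i+2j+a, i) ) = 2^{binom(n,2)} · (∏_{i=0}^{n-1} (a + 2i − 1)) / n!. -/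
/-- A difference of consecutive binomial coefficients in terms of falling factorials. -/
theorem Nat.cast_choose_succ_sub_choose {m i : ℕ} (h : i ≤ m) :
    ((m.choose (i + 1) : ℚ) - (m.choose i : ℚ)) =
      ((i + 1).factorial : ℚ)⁻¹ * (((m : ℚ) - 2 * i - 1) * m.descFactorial i) := by
  have hs : (m.choose (i + 1) : ℚ) * (i + 1) = m.choose i * ((m : ℚ) - i) := by
    rw [← Nat.cast_sub h]
    exact_mod_cast Nat.choose_succ_right_eq m i
  have hf : (i.factorial : ℚ) ≠ 0 := by positivity
  have hi : (i : ℚ) + 1 ≠ 0 := by positivity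
  rw [Nat.descFactorial_eq_factorial_mul_choose, Nat.factorial_succ]
  push_cast
  field_simp
  linear_combination hs

namespace Matrix

/-- The Vandermonde determinant of a scaled family of nodes. -/
theorem det_vandermonde_smul {R : Type*} [CommRing R] {n : ℕ} (c : R) (v : Fin n → R) :
    (vandermonde fun i => c * v i).det = c ^ n.choose 2 * (vandermonde v).det := by
  have h : (vandermonde fun i => c * v i) =
      of fun i j : Fin n => c ^ (j : ℕ) * vandermonde v i j := by
    ext i j
    simp [vandermonde_apply, mul_pow]
  rw [h, det_mul_row, Finset.prod_pow_eq_pow_sum, Fin.sum_univ_eq_sum_range (fun i => i),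
    Finset.sum_range_id, Nat.choose_two_right]

open Polynomial in
/-- A determinant of shifted falling factorials is a Vandermonde determinant. -/
theorem det_descFactorial_add {n : ℕ} (s v : Fin n → ℕ) :
    (of fun i j : Fin n => (((s i + v j).descFactorial i : ℕ) : ℚ)).det =
      (vandermonde fun i => (v i : ℚ)).det := by
  have hd (i : Fin n) : ((descPochhammer ℚ i).comp (X + C (s i : ℚ))).natDegree = i := by
    rw [natDegree_comp, natDegree_X_add_C, descPochhammer_natDegree, mul_one]
  have hm (i : Fin n) : ((descPochhammer ℚ i).comp (X + C (s i : ℚ))).Monic :=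
    (monic_descPochhammer ℚ i).comp_X_add_C _
  rw [det_eval_matrixOfPolynomials_eq_det_vandermonde _ _ hd hm, ← det_transpose]
  congr 1
  ext i j
  have h := descPochhammer_eval_eq_descFactorial ℚ (s j + v i) j
  push_cast at h
  simp [← h, add_comm]

end Matrix

/-- Theorem 5 of Krattenthaler:
`det (C(2i+2j+a, i+1) - C(2i+2j+a, i)) = 2^(n choose 2) ∏_{i=0}^{n-1} (a+2i-1) / n!`
as an identity of rational numbers. -/
theorem stmt_5 (n a : ℕ) (hn : 1 ≤ n) :
    Matrix.det (Matrix.of fun i j : Fin n =>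
      ((Nat.choose (2 * i.val + 2 * j.val + a) (i.val + 1) : ℚ) -
        (Nat.choose (2 * i.val + 2 * j.val + a) i.val : ℚ))) =
      2 ^ n.choose 2 * (∏ i ∈ Finset.range n, ((a : ℚ) + 2 * i - 1)) /
        (n.factorial : ℚ) := by
  obtain ⟨k, rfl⟩ := Nat.exists_eq_add_of_le' hn
  have hM : (Matrix.of fun i j : Fin (k + 1) =>
      ((Nat.choose (2 * i.val + 2 * j.val + a) (i.val + 1) : ℚ) -
        (Nat.choose (2 * i.val + 2 * j.val + a) i.val : ℚ))) =
      Matrix.of fun i j : Fin (k + 1) => ((i.val + 1).factorial : ℚ)⁻¹ *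
        (Matrix.of fun i j : Fin (k + 1) => ((a : ℚ) + 2 * j.val - 1) *
          (Matrix.of fun i j : Fin (k + 1) =>
            (((2 * i.val + (2 * j.val + a)).descFactorial i.val : ℕ) : ℚ)) i j) i j := by
    ext i j
    simp only [Matrix.of_apply]
    rw [Nat.cast_choose_succ_sub_choose (by omega), add_assoc]
    push_cast
    ring
  rw [hM, Matrix.det_mul_column, Matrix.det_mul_row,
    Matrix.det_descFactorial_add (fun i => 2 * i.val) (fun j => 2 * j.val + a)]
  push_cast
  rw [Matrix.det_vandermonde_add, Matrix.det_vandermonde_smul,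
    Matrix.det_vandermonde_id_eq_superFactorial,
    Fin.prod_univ_eq_prod_range (fun i => (a : ℚ) + 2 * i - 1),
    Fin.prod_univ_eq_prod_range (fun i => ((i + 1).factorial : ℚ)⁻¹), Finset.prod_inv_distrib,
    ← Nat.cast_prod, Nat.prod_range_factorial_succ, Nat.superFactorial_succ]
  have hf : ((k + 1).factorial : ℚ) ≠ 0 := by positivity
  have hs : (k.superFactorial : ℚ) ≠ 0 := by
    rw [← Nat.prod_range_factorial_succ, Nat.cast_prod]
    exact Finset.prod_ne_zero_iff.2 fun i _ => by positivity
  push_cast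
  field_simp
end

section
/- Let n ≥ 1 be an integer and let X and Y be nonnegative integers. Then, as an identity of rational numbers, det_{0≤i,j≤2n-1}( (i − j) · (X+i+j)! / (Y+i+j)! ) = ( ∏_{i=0}^{2n-1} (X+i)! / (Y+i+2n-1)! ) · ∏_{i=0}^{n-1} ((2i+1)!)^2 · (X+2i+1) · (Y+4n−2i−2) · (X−Y−2i)^{2n−2i−2} · (X−Y−2i−1)^{2n−2i−2}. -/
open Finset Polynomial

/-- The `k`-th alternating binomial sum annihilates polynomials of degree less than `k`. -/
lemma sum_neg_one_pow_choose_mul_eval_eq_zero {P : ℚ[X]} {k : ℕ} (hP : P.natDegree < k) :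
    ∑ i ∈ range (k + 1), (-1 : ℚ) ^ (k - i) * k.choose i * P.eval (i : ℚ) = 0 := by
  have h := congrFun (Polynomial.fwdDiff_iter_eq_zero_of_degree_lt hP) 0
  rw [fwdDiff_iter_eq_sum_shift] at h
  simpa [zsmul_eq_mul] using h

lemma fwdDiff_iter_inv_add {a : ℚ} (ha : 0 < a) (k y : ℕ) :
    (fwdDiff 1)^[k] (fun i : ℕ => ((i : ℚ) + a)⁻¹) y =
      (-1) ^ k * k.factorial / ∏ s ∈ range (k + 1), ((y : ℚ) + s + a) := by
  induction k generalizing y with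
  | zero => simp
  | succ k ih =>
    rw [Function.iterate_succ_apply', fwdDiff, ih, ih]
    have hpos : ∀ z m : ℕ, ∏ s ∈ range m, ((z : ℚ) + s + a) ≠ 0 := fun z m =>
      prod_ne_zero_iff.mpr fun s _ => by positivity
    have h1 : ∏ s ∈ range (k + 2), ((y : ℚ) + s + a) =
        (∏ s ∈ range (k + 1), (((y + 1 : ℕ) : ℚ) + s + a)) * (y + a) := by
      rw [prod_range_succ']
      congr 1
      · refine prod_congr rfl fun s _ => ?_
        push_cast
        ring
      · simp
    have h2 : ∏ s ∈ range (k + 2), ((y : ℚ) + s + a) =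
        (∏ s ∈ range (k + 1), ((y : ℚ) + s + a)) * (y + (k + 1) + a) := by
      rw [prod_range_succ]
      push_cast
      ring
    have e1 : (-1 : ℚ) ^ k * k.factorial / ∏ s ∈ range (k + 1), (((y + 1 : ℕ) : ℚ) + s + a) =
        (-1 : ℚ) ^ k * k.factorial * (y + a) / ∏ s ∈ range (k + 2), ((y : ℚ) + s + a) := by
      rw [h1, mul_div_mul_right _ _ (by positivity)]
    have e2 : (-1 : ℚ) ^ k * k.factorial / ∏ s ∈ range (k + 1), ((y : ℚ) + s + a) =
        (-1 : ℚ) ^ k * k.factorial * (y + (k + 1) + a) /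
          ∏ s ∈ range (k + 2), ((y : ℚ) + s + a) := by
      rw [h2, mul_div_mul_right _ _ (by positivity)]
    rw [e1, e2, ← sub_div, Nat.factorial_succ]
    push_cast
    ring

lemma sum_neg_one_pow_choose_mul_inv_add {a : ℚ} (ha : 0 < a) (k : ℕ) :
    ∑ i ∈ range (k + 1), (-1 : ℚ) ^ (k - i) * k.choose i * ((i : ℚ) + a)⁻¹ =
      (-1) ^ k * k.factorial / ∏ s ∈ range (k + 1), ((s : ℚ) + a) := by
  have h := fwdDiff_iter_inv_add ha k 0
  rw [fwdDiff_iter_eq_sum_shift] at h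
  simpa [zsmul_eq_mul] using h

/-- Alternating binomial sum of a polynomial of degree at most `k` divided by a linear factor. -/
lemma sum_neg_one_pow_choose_mul_eval_div_add {a : ℚ} (ha : 0 < a) {P : ℚ[X]} {k : ℕ}
    (hk : 0 < k) (hP : P.natDegree ≤ k) :
    ∑ i ∈ range (k + 1), (-1 : ℚ) ^ (k - i) * k.choose i * (P.eval (i : ℚ) / ((i : ℚ) + a)) =
      P.eval (-a) * ((-1) ^ k * k.factorial / ∏ s ∈ range (k + 1), ((s : ℚ) + a)) := by
  set Q := P /ₘ (X - C (-a)) with hQ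
  have hdeg : Q.natDegree < k := by
    rw [hQ, natDegree_divByMonic _ (monic_X_sub_C _), natDegree_X_sub_C]
    lia
  have hdec : ∀ x : ℚ, P.eval x = P.eval (-a) + (x + a) * Q.eval x := fun x => by
    have h := congrArg (Polynomial.eval x) (modByMonic_add_div P (X - C (-a)))
    rw [modByMonic_X_sub_C_eq_C_eval] at h
    simpa [hQ] using h.symm
  rw [← sum_neg_one_pow_choose_mul_inv_add ha, mul_sum,
    ← add_zero (∑ i ∈ range (k + 1), P.eval (-a) * _),
    ← sum_neg_one_pow_choose_mul_eval_eq_zero hdeg, ← sum_add_distrib]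
  refine sum_congr rfl fun i _ => ?_
  have : (i : ℚ) + a ≠ 0 := by positivity
  rw [hdec i]
  field_simp

/-- The polynomial `(x + c + 1) (x + c + 2) ⋯ (x + c + m)`. -/
noncomputable def shiftedAscPochhammer (c : ℚ) (m : ℕ) : ℚ[X] :=
  ∏ s ∈ range m, (X + C (c + s + 1))

lemma natDegree_shiftedAscPochhammer_le (c : ℚ) (m : ℕ) :
    (shiftedAscPochhammer c m).natDegree ≤ m := by
  refine (natDegree_prod_le _ _).trans ?_
  simp only [natDegree_X_add_C]
  simp

lemma eval_shiftedAscPochhammer (c : ℚ) (m : ℕ) (x : ℚ) :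
    (shiftedAscPochhammer c m).eval x = ∏ s ∈ range m, (x + (c + s + 1)) := by
  simp [shiftedAscPochhammer, eval_prod]

lemma eval_shiftedAscPochhammer_mul_factorial (c m i : ℕ) :
    (shiftedAscPochhammer c m).eval (i : ℚ) * ((c + i).factorial : ℚ) =
      ((c + i + m).factorial : ℚ) := by
  rw [eval_shiftedAscPochhammer]
  induction m with
  | zero => simp
  | succ m ih =>
    rw [prod_range_succ, ← add_assoc (c + i), Nat.factorial_succ, Nat.cast_mul, ← ih]
    push_cast
    ring

/-- Determinant of a tridiagonal matrix of even size with zero diagonal. -/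
lemma det_tridiagonal_zero_diagonal {R : Type*} [CommRing R] (n : ℕ) (T : ℕ → ℕ → R)
    (hT : ∀ k l, k + 1 ≠ l → l + 1 ≠ k → T k l = 0) :
    Matrix.det (Matrix.of fun i j : Fin (2 * n) => T i j) =
      ∏ m ∈ range n, -(T (2 * m) (2 * m + 1) * T (2 * m + 1) (2 * m)) := by
  induction n generalizing T with
  | zero => simp
  | succ n ih =>
    have hrec := ih (fun k l => T (k + 2) (l + 2)) fun k l h1 h2 => hT _ _ (by lia) (by lia)
    have hone : ∀ j : Fin (2 * n), (1 : Fin (2 * n + 2)).succAbove j.succ = j.succ.succ :=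
      fun j => Fin.succ_succAbove_succ 0 j
    have hone' : (1 : Fin (2 * n + 2)).succAbove 0 = 0 := Fin.succ_succAbove_zero 0
    rw [prod_range_succ']
    change Matrix.det (Matrix.of fun i j : Fin (2 * n + 1 + 1) => T i j) = _
    rw [Matrix.det_succ_row_zero, Finset.sum_eq_single 1, Matrix.det_succ_column_zero,
      Finset.sum_eq_single 0]
    · have hsub : ((Matrix.of fun i j : Fin (2 * n + 1 + 1) => T i j).submatrix Fin.succ
          (Fin.succAbove 1)).submatrix (Fin.succAbove 0) Fin.succ =
          Matrix.of fun i j : Fin (2 * n) => T (i + 2) (j + 2) := by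
        ext i j
        simp [hone]
      rw [hsub, hrec]
      simp [hone']
      ring_nf
    · intro i _ hi
      have : (i : ℕ) ≠ 0 := fun h => hi (Fin.ext h)
      simp [hone', hT (i + 1) 0 (by lia) (by lia)]
    · simp
    · intro j _ hj
      have : (j : ℕ) ≠ 1 := fun h => hj (Fin.ext (by simpa using h))
      simp [hT 0 j (by lia) (by lia)]
    · simp

/-- The entry `(i - j) (X+i+j)! / (Y+i+j)!`. -/
def skewHankelEntry (X Y i j : ℕ) : ℚ :=
  ((i : ℚ) - (j : ℚ)) * ((X + i + j).factorial : ℚ) / ((Y + i + j).factorial : ℚ)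

lemma skewHankelEntry_swap (X Y i j : ℕ) :
    skewHankelEntry X Y j i = -skewHankelEntry X Y i j := by
  rw [skewHankelEntry, skewHankelEntry, add_right_comm X, add_right_comm Y]
  ring

/-- The coefficient of `x ^ i` in the monic Jacobi polynomial of degree `k` whose weight has moments
`(X+m)! / (Y+m-1)!`. -/
def jacobiCoeff (X Y k i : ℕ) : ℚ :=
  (-1) ^ (k - i) * k.choose i * (((X + k).factorial : ℚ) / (X + i).factorial) *
    (((Y + k + i - 2).factorial : ℚ) / (Y + k + k - 2).factorial)

lemma jacobiCoeff_self (X Y k : ℕ) : jacobiCoeff X Y k k = 1 := by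
  have h1 : ((X + k).factorial : ℚ) ≠ 0 := by positivity
  have h2 : ((Y + k + k - 2).factorial : ℚ) ≠ 0 := by positivity
  simp [jacobiCoeff, h1, h2]

lemma jacobiCoeff_eq_zero (X Y : ℕ) {k i : ℕ} (h : k < i) : jacobiCoeff X Y k i = 0 := by
  simp [jacobiCoeff, Nat.choose_eq_zero_of_lt h]

/-- The skew pairing of the Jacobi polynomial of degree `k` with `x ^ j`. -/
def jacobiMonomialPairing (X Y k j : ℕ) : ℚ :=
  ∑ i ∈ range (k + 1), jacobiCoeff X Y k i * skewHankelEntry X Y i j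

/-- The skew pairing of the Jacobi polynomials of degrees `k` and `l`. -/
def jacobiPairing (X Y k l : ℕ) : ℚ :=
  ∑ j ∈ range (l + 1), jacobiMonomialPairing X Y k j * jacobiCoeff X Y l j

lemma jacobiMonomialPairing_eq_zero (X Y : ℕ) {k j : ℕ} (h : j + 2 ≤ k) :
    jacobiMonomialPairing X Y k j = 0 := by
  obtain ⟨d, rfl⟩ := Nat.exists_eq_add_of_le h
  set k := j + 2 + d with hk
  set P : ℚ[X] := (Polynomial.X - C (j : ℚ)) * shiftedAscPochhammer X j *
    shiftedAscPochhammer (Y + j : ℕ) d with hPdef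
  have hP : P.natDegree < k := by
    have h1 := natDegree_shiftedAscPochhammer_le X j
    have h2 := natDegree_shiftedAscPochhammer_le (Y + j : ℕ) d
    have h3 := natDegree_X_sub_C (j : ℚ)
    have h4 := natDegree_mul_le (p := (Polynomial.X - C (j : ℚ)) * shiftedAscPochhammer X j)
      (q := shiftedAscPochhammer (Y + j : ℕ) d)
    have h5 := natDegree_mul_le (p := Polynomial.X - C (j : ℚ)) (q := shiftedAscPochhammer X j)
    lia
  have hsum := sum_neg_one_pow_choose_mul_eval_eq_zero hP
  rw [jacobiMonomialPairing, ← mul_zero (((X + k).factorial : ℚ) / (Y + k + k - 2).factorial),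
    ← hsum, mul_sum]
  refine sum_congr rfl fun i _ => ?_
  have e1 := eval_shiftedAscPochhammer_mul_factorial X j i
  have e2 := eval_shiftedAscPochhammer_mul_factorial (Y + j) d i
  rw [jacobiCoeff, skewHankelEntry, show Y + k + i - 2 = Y + j + i + d by lia,
    show Y + i + j = Y + j + i by lia, ← e1, ← e2]
  simp only [hPdef, eval_mul, eval_sub, eval_X, eval_C]
  have p1 : ((X + i).factorial : ℚ) ≠ 0 := by positivity
  have p2 : ((Y + j + i).factorial : ℚ) ≠ 0 := by positivity
  have p3 : ((Y + k + k - 2).factorial : ℚ) ≠ 0 := by positivity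
  field_simp

lemma prod_range_add_factorial (a k : ℕ) :
    (∏ s ∈ range k, ((s : ℚ) + ((a : ℚ) + 1))) * a.factorial = (a + k).factorial := by
  have h := eval_shiftedAscPochhammer_mul_factorial a k 0
  rw [eval_shiftedAscPochhammer] at h
  simp only [add_zero] at h
  rw [← h]
  congr 1
  refine prod_congr rfl fun s _ => ?_
  push_cast
  ring

lemma jacobiMonomialPairing_subdiagonal (X Y e : ℕ) :
    jacobiMonomialPairing X Y (e + 2) (e + 1) =
      ((X + e + 2).factorial : ℚ) / (Y + 2 * e + 2).factorial *
        (-((Y : ℚ) + 2 * e + 2) * ∏ s ∈ range (e + 1), ((X : ℚ) - Y - e + s)) *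
        ((-1) ^ e * (e + 2).factorial * (Y + e).factorial / (Y + 2 * e + 3).factorial) := by
  set k := e + 2 with hk
  set P : ℚ[X] := (Polynomial.X - C ((e + 1 : ℕ) : ℚ)) * shiftedAscPochhammer X (e + 1) with hPdef
  have hP : P.natDegree ≤ k := by
    have h1 := natDegree_shiftedAscPochhammer_le X (e + 1)
    have h3 := natDegree_X_sub_C ((e + 1 : ℕ) : ℚ)
    have h5 := natDegree_mul_le (p := Polynomial.X - C ((e + 1 : ℕ) : ℚ))
      (q := shiftedAscPochhammer X (e + 1))
    lia
  have hsum := sum_neg_one_pow_choose_mul_eval_div_add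
    (a := ((Y + e : ℕ) : ℚ) + 1) (by positivity) (by lia) hP
  have hprod := prod_range_add_factorial (Y + e) (k + 1)
  have hpos : ∏ s ∈ range (k + 1), ((s : ℚ) + (((Y + e : ℕ) : ℚ) + 1)) ≠ 0 :=
    prod_ne_zero_iff.mpr fun s _ => by positivity
  have hfrac : (-1 : ℚ) ^ k * k.factorial /
      ∏ s ∈ range (k + 1), ((s : ℚ) + (((Y + e : ℕ) : ℚ) + 1)) =
      (-1) ^ e * (e + 2).factorial * (Y + e).factorial / (Y + 2 * e + 3).factorial := by
    rw [show Y + 2 * e + 3 = Y + e + (k + 1) by lia, ← hprod,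
      mul_div_mul_right _ _ (by positivity), hk, pow_add]
    norm_num
  have heval : P.eval (-(((Y + e : ℕ) : ℚ) + 1)) =
      -((Y : ℚ) + 2 * e + 2) * ∏ s ∈ range (e + 1), ((X : ℚ) - Y - e + s) := by
    rw [hPdef, eval_mul, eval_shiftedAscPochhammer]
    simp only [eval_sub, eval_X, eval_C]
    congr 1
    · push_cast
      ring
    · refine prod_congr rfl fun s _ => ?_
      push_cast
      ring
  rw [hfrac, heval] at hsum
  rw [jacobiMonomialPairing, mul_assoc (_ / _), ← hsum, mul_sum]
  refine sum_congr rfl fun i _ => ?_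
  have e1 := eval_shiftedAscPochhammer_mul_factorial X (e + 1) i
  rw [jacobiCoeff, skewHankelEntry, show Y + k + i - 2 = Y + e + i by lia,
    show Y + k + k - 2 = Y + 2 * e + 2 by lia,
    show Y + i + (e + 1) = Y + e + i + 1 by lia, ← e1, Nat.factorial_succ (Y + e + i)]
  simp only [hPdef, eval_mul, eval_sub, eval_X, eval_C]
  have p1 : ((X + i).factorial : ℚ) ≠ 0 := by positivity
  have p2 : ((Y + e + i).factorial : ℚ) ≠ 0 := by positivity
  have p3 : ((Y + 2 * e + 2).factorial : ℚ) ≠ 0 := by positivity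
  have p4 : (Y : ℚ) + e + i + 1 ≠ 0 := by positivity
  have p5 : (i : ℚ) + (Y + e + 1) ≠ 0 := by positivity
  push_cast
  rw [show X + k = X + e + 2 by lia]
  field_simp
  ring

lemma jacobiPairing_eq_zero_of_add_two_le (X Y : ℕ) {k l : ℕ} (h : l + 2 ≤ k) :
    jacobiPairing X Y k l = 0 :=
  sum_eq_zero fun j hj => by
    rw [jacobiMonomialPairing_eq_zero X Y (by have := mem_range.1 hj; lia), zero_mul]

lemma jacobiPairing_succ_self (X Y k : ℕ) :
    jacobiPairing X Y (k + 1) k = jacobiMonomialPairing X Y (k + 1) k := by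
  rw [jacobiPairing, sum_range_succ, jacobiCoeff_self, mul_one, sum_eq_zero, zero_add]
  intro j hj
  rw [jacobiMonomialPairing_eq_zero X Y (by have := mem_range.1 hj; lia), zero_mul]

lemma jacobiPairing_swap (X Y k l : ℕ) : jacobiPairing X Y l k = -jacobiPairing X Y k l := by
  simp only [jacobiPairing, jacobiMonomialPairing, sum_mul]
  rw [sum_comm, ← sum_neg_distrib]
  refine sum_congr rfl fun i _ => ?_
  rw [← sum_neg_distrib]
  refine sum_congr rfl fun j _ => ?_
  rw [skewHankelEntry_swap]
  ring

lemma jacobiPairing_eq_zero (X Y k l : ℕ) (h1 : k + 1 ≠ l) (h2 : l + 1 ≠ k) :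
    jacobiPairing X Y k l = 0 := by
  rcases lt_trichotomy k l with h | rfl | h
  · rw [jacobiPairing_swap, jacobiPairing_eq_zero_of_add_two_le X Y (by lia), neg_zero]
  · have := jacobiPairing_swap X Y k k
    linarith
  · exact jacobiPairing_eq_zero_of_add_two_le X Y (by lia)

lemma det_skewHankel_eq_det_jacobiPairing (X Y N : ℕ) :
    Matrix.det (Matrix.of fun i j : Fin N => skewHankelEntry X Y i j) =
      Matrix.det (Matrix.of fun i j : Fin N => jacobiPairing X Y i j) := by
  set L : Matrix (Fin N) (Fin N) ℚ := Matrix.of fun i j => jacobiCoeff X Y i j with hL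
  have hdet : L.det = 1 := by
    rw [Matrix.det_of_isLowerTriangular L fun i j h => jacobiCoeff_eq_zero X Y h]
    exact prod_eq_one fun i _ => jacobiCoeff_self X Y i
  have hext : ∀ (f : ℕ → ℚ) (k : Fin N), (∀ i, (k : ℕ) < i → f i = 0) →
      ∑ i : Fin N, f i = ∑ i ∈ range (k + 1), f i := fun f k hf => by
    rw [Fin.sum_univ_eq_sum_range]
    refine (sum_subset (range_mono k.2) fun i _ hi => hf i ?_).symm
    rw [mem_range] at hi
    lia
  have hmul : (Matrix.of fun i j : Fin N => jacobiPairing X Y i j) =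
      L * (Matrix.of fun i j : Fin N => skewHankelEntry X Y i j) * L.transpose := by
    ext k l
    simp only [Matrix.mul_apply, Matrix.of_apply, Matrix.transpose_apply, hL]
    have hrow : ∀ j : Fin N, ∑ i : Fin N, jacobiCoeff X Y k i * skewHankelEntry X Y i j =
        jacobiMonomialPairing X Y k j := fun j =>
      hext (fun i => jacobiCoeff X Y k i * skewHankelEntry X Y i j) k fun i hi => by
        rw [jacobiCoeff_eq_zero X Y hi, zero_mul]
    simp only [hrow]
    exact (hext (fun j => jacobiMonomialPairing X Y k j * jacobiCoeff X Y l j) l fun j hj => by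
      rw [jacobiCoeff_eq_zero X Y hj, mul_zero]).symm
  rw [hmul, Matrix.det_mul, Matrix.det_mul, Matrix.det_transpose, hdet, one_mul, mul_one]

lemma det_skewHankel_eq_prod_sq (X Y n : ℕ) :
    Matrix.det (Matrix.of fun i j : Fin (2 * n) => skewHankelEntry X Y i j) =
      ∏ m ∈ range n, jacobiMonomialPairing X Y (2 * m + 1) (2 * m) ^ 2 := by
  rw [det_skewHankel_eq_det_jacobiPairing,
    det_tridiagonal_zero_diagonal n _ (jacobiPairing_eq_zero X Y)]
  refine prod_congr rfl fun m _ => ?_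
  rw [jacobiPairing_swap X Y (2 * m + 1), jacobiPairing_succ_self]
  ring

lemma prod_range_shift_two {M : Type*} [CommMonoid M] (f : ℕ → M) (m : ℕ) :
    (∏ i ∈ range m, f (i + 2)) * (f 0 * f 1) = (∏ i ∈ range m, f i) * (f m * f (m + 1)) := by
  rw [← mul_assoc (∏ i ∈ range m, f i), ← prod_range_succ, ← prod_range_succ, prod_range_succ',
    prod_range_succ', mul_assoc, mul_comm (f 0)]

lemma prod_range_succ_pow_two_mul_sub {R : Type*} [CommMonoid R] (g : ℕ → R) (n : ℕ) :
    ∏ i ∈ range (n + 1), g i ^ (2 * (n + 1) - 2 * i - 2) =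
      (∏ i ∈ range n, g i ^ (2 * n - 2 * i - 2)) * ∏ i ∈ range n, g i ^ 2 := by
  rw [prod_range_succ, ← prod_mul_distrib, show 2 * (n + 1) - 2 * n - 2 = 0 by lia, pow_zero,
    mul_one]
  refine prod_congr rfl fun i hi => ?_
  have := mem_range.1 hi
  rw [← pow_add]
  congr 1
  lia

lemma prod_range_two_mul {M : Type*} [CommMonoid M] (f : ℕ → M) (n : ℕ) :
    ∏ i ∈ range (2 * n), f i = ∏ i ∈ range n, (f (2 * i) * f (2 * i + 1)) := by
  induction n with
  | zero => simp
  | succ n ih =>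
    rw [mul_add, mul_one, prod_range_succ, prod_range_succ, ih, prod_range_succ, mul_assoc]

lemma prod_factorial_step (Y n : ℕ) (hn : 1 ≤ n) :
    (∏ i ∈ range (2 * (n + 1)), ((Y + i + 2 * (n + 1) - 1).factorial : ℚ)) *
        ((Y + 2 * n - 1).factorial * (Y + 2 * n).factorial) =
      (∏ i ∈ range (2 * n), ((Y + i + 2 * n - 1).factorial : ℚ)) *
        ((Y + 4 * n - 1).factorial * (Y + 4 * n).factorial *
          ((Y + 4 * n + 1).factorial * (Y + 4 * n + 2).factorial)) := by
  obtain ⟨N, hN⟩ : ∃ N, Y + 2 * n = N + 1 := ⟨Y + 2 * n - 1, by lia⟩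
  have h := prod_range_shift_two (fun i => ((N + i).factorial : ℚ)) (2 * n + 2)
  rw [prod_range_succ (fun i => ((N + i).factorial : ℚ)) (2 * n + 1),
    prod_range_succ (fun i => ((N + i).factorial : ℚ)) (2 * n)] at h
  have e1 : ∏ i ∈ range (2 * (n + 1)), ((Y + i + 2 * (n + 1) - 1).factorial : ℚ) =
      ∏ i ∈ range (2 * n + 2), ((N + (i + 2)).factorial : ℚ) :=
    prod_congr rfl fun i _ => by congr 2; lia
  have e2 : ∏ i ∈ range (2 * n), ((Y + i + 2 * n - 1).factorial : ℚ) =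
      ∏ i ∈ range (2 * n), ((N + i).factorial : ℚ) :=
    prod_congr rfl fun i _ => by congr 2; lia
  rw [e1, e2, hN, Nat.add_sub_cancel, show Y + 4 * n - 1 = N + 2 * n by lia,
    show Y + 4 * n = N + (2 * n + 1) by lia]
  linear_combination h

lemma prod_linear_step (y : ℚ) (n : ℕ) :
    (∏ i ∈ range (n + 1), (y + 4 * (n + 1 : ℕ) - 2 * i - 2)) * (y + 2 * n) =
      (∏ i ∈ range n, (y + 4 * n - 2 * i - 2)) * ((y + 4 * n) * (y + 4 * n + 2)) := by
  have h (m : ℕ) : ∏ i ∈ range m, (y + 4 * m - 2 * i - 2) =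
      ∏ i ∈ range m, (y + 2 * m + 2 * i) := by
    rw [← prod_range_reflect]
    refine prod_congr rfl fun i hi => ?_
    rw [Nat.cast_sub (by have := mem_range.1 hi; lia),
      Nat.cast_sub (by have := mem_range.1 hi; lia)]
    push_cast
    ring
  have h' : (∏ i ∈ range (n + 1), (y + 2 * (n + 1 : ℕ) + 2 * i)) * (y + 2 * n) =
      ∏ i ∈ range (n + 2), (y + 2 * n + 2 * i) := by
    rw [prod_range_succ' _ (n + 1)]
    congr 1
    · refine prod_congr rfl fun i _ => ?_
      push_cast
      ring
    · simp
  rw [h, h, h', prod_range_succ, prod_range_succ]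
  push_cast
  ring

lemma jacobiMonomialPairing_sq_step (X Y n : ℕ) (hn : 1 ≤ n) :
    jacobiMonomialPairing X Y (2 * n + 1) (2 * n) ^ 2 =
      (((X + 2 * n + 1).factorial : ℚ) * (2 * n + 1).factorial * (Y + 2 * n - 1).factorial *
        (Y + 4 * n) / ((Y + 4 * n).factorial * (Y + 4 * n + 1).factorial)) ^ 2 *
        (∏ t ∈ range (2 * n), ((X : ℚ) - Y - t)) ^ 2 := by
  obtain ⟨e, he⟩ : ∃ e, 2 * n = e + 1 := ⟨2 * n - 1, by lia⟩
  have hcast : 2 * (n : ℚ) = e + 1 := by exact_mod_cast he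
  have hprod : ∏ s ∈ range (e + 1), ((X : ℚ) - Y - e + s) =
      ∏ t ∈ range (e + 1), ((X : ℚ) - Y - t) := by
    rw [← prod_range_reflect]
    refine prod_congr rfl fun i hi => ?_
    rw [Nat.cast_sub (by have := mem_range.1 hi; lia),
      Nat.cast_sub (by have := mem_range.1 hi; lia)]
    push_cast
    ring
  rw [show 4 * n = 2 * e + 2 by lia, show (4 * (n : ℚ)) = 2 * e + 2 by linarith, he,
    jacobiMonomialPairing_subdiagonal, hprod]
  have hsq : ((-1 : ℚ) ^ e) ^ 2 = 1 := by rw [← pow_mul, mul_comm, pow_mul]; simp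
  rw [show Y + (e + 1) - 1 = Y + e by lia]
  simp only [mul_pow, div_pow, hsq, ← add_assoc]
  ring

lemma prod_sq_jacobiMonomialPairing (X Y n : ℕ) (hn : 1 ≤ n) :
    ∏ m ∈ range n, jacobiMonomialPairing X Y (2 * m + 1) (2 * m) ^ 2 =
      (∏ i ∈ range (2 * n),
        ((X + i).factorial : ℚ) / ((Y + i + 2 * n - 1).factorial : ℚ)) *
      ∏ i ∈ range n,
        ((2 * i + 1).factorial : ℚ) ^ 2 * ((X : ℚ) + 2 * i + 1) *
          ((Y : ℚ) + 4 * n - 2 * i - 2) *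
          ((X : ℚ) - (Y : ℚ) - 2 * i) ^ (2 * n - 2 * i - 2) *
          ((X : ℚ) - (Y : ℚ) - 2 * i - 1) ^ (2 * n - 2 * i - 2) := by
  induction n, hn using Nat.le_induction with
  | base =>
    have p1 : (Y.factorial : ℚ) ≠ 0 := by positivity
    have p2 : (X.factorial : ℚ) ≠ 0 := by positivity
    have p3 : (Y : ℚ) + 1 ≠ 0 := by positivity
    have p4 : (Y : ℚ) + 1 + 1 ≠ 0 := by positivity
    have h : jacobiMonomialPairing X Y 1 0 = ((X + 1).factorial : ℚ) / (Y + 1).factorial := by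
      rw [jacobiMonomialPairing, sum_range_succ, jacobiCoeff_self]
      simp [skewHankelEntry]
    simp only [prod_range_succ, prod_range_zero, mul_one, mul_zero, zero_add, h]
    simp [Nat.factorial_succ]
    field_simp
    ring
  | succ n hn ih =>
    rw [prod_range_succ, ih, jacobiMonomialPairing_sq_step X Y n hn]
    simp only [prod_mul_distrib, prod_div_distrib]
    rw [prod_range_succ_pow_two_mul_sub (fun i : ℕ => (X : ℚ) - (Y : ℚ) - 2 * i),
      prod_range_succ_pow_two_mul_sub (fun i : ℕ => (X : ℚ) - (Y : ℚ) - 2 * i - 1),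
      prod_range_two_mul (fun t : ℕ => (X : ℚ) - Y - t), prod_mul_distrib]
    have hfac := prod_factorial_step Y n hn
    have hlin := prod_linear_step (Y : ℚ) n
    have hD : ∏ i ∈ range (2 * n), ((Y + i + 2 * n - 1).factorial : ℚ) ≠ 0 :=
      prod_ne_zero_iff.mpr fun i _ => by positivity
    have hY : (Y : ℚ) + 2 * n ≠ 0 := by positivity
    have hY4 : (Y : ℚ) + 4 * n ≠ 0 := by positivity
    have hY42 : (Y : ℚ) + 4 * n + 2 ≠ 0 := by positivity
    have f1 : ((Y + 2 * n).factorial : ℚ) = (Y + 2 * n) * (Y + 2 * n - 1).factorial := by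
      rw [← Nat.mul_factorial_pred (by lia : Y + 2 * n ≠ 0)]
      push_cast
      rfl
    have f2 : ((Y + 4 * n).factorial : ℚ) = (Y + 4 * n) * (Y + 4 * n - 1).factorial := by
      rw [← Nat.mul_factorial_pred (by lia : Y + 4 * n ≠ 0)]
      push_cast
      rfl
    have f3 : ((Y + 4 * n + 2).factorial : ℚ) = (Y + 4 * n + 2) * (Y + 4 * n + 1).factorial := by
      rw [Nat.factorial_succ (Y + 4 * n + 1)]
      push_cast
      ring
    have f4 : ((X + 2 * n + 1).factorial : ℚ) = (X + 2 * n + 1) * (X + 2 * n).factorial := by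
      rw [Nat.factorial_succ]
      push_cast
      rfl
    have hu : ((Y + 2 * n - 1).factorial : ℚ) ≠ 0 := by positivity
    have hv : ((Y + 4 * n - 1).factorial : ℚ) ≠ 0 := by positivity
    have hw : ((Y + 4 * n + 1).factorial : ℚ) ≠ 0 := by positivity
    rw [f1, f2, f3, ← eq_div_iff (by positivity)] at hfac
    rw [← eq_div_iff hY] at hlin
    rw [hfac, hlin, f2, mul_add 2 n 1, mul_one, prod_range_succ _ (2 * n + 1),
      prod_range_succ _ (2 * n), prod_range_succ _ n, prod_range_succ _ n, ← add_assoc X (2 * n) 1,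
      f4]
    simp only [prod_pow, Nat.cast_add, Nat.cast_mul, Nat.cast_ofNat, Nat.cast_one, ← sub_sub]
    field_simp

/-- Theorem 6 of Krattenthaler: evaluation of
`det ((i - j) (X+i+j)! / (Y+i+j)!)` for nonnegative integers `X`, `Y`,
as an identity of rational numbers. -/
theorem stmt_6 (n : ℕ) (hn : 1 ≤ n) (X Y : ℕ) :
    Matrix.det (Matrix.of fun i j : Fin (2 * n) =>
      ((i.val : ℚ) - (j.val : ℚ)) * ((X + i.val + j.val).factorial : ℚ) /
        ((Y + i.val + j.val).factorial : ℚ)) =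
      (∏ i ∈ Finset.range (2 * n),
        ((X + i).factorial : ℚ) / ((Y + i + 2 * n - 1).factorial : ℚ)) *
      ∏ i ∈ Finset.range n,
        ((2 * i + 1).factorial : ℚ) ^ 2 * ((X : ℚ) + 2 * i + 1) *
          ((Y : ℚ) + 4 * n - 2 * i - 2) *
          ((X : ℚ) - (Y : ℚ) - 2 * i) ^ (2 * n - 2 * i - 2) *
          ((X : ℚ) - (Y : ℚ) - 2 * i - 1) ^ (2 * n - 2 * i - 2) :=
  (det_skewHankel_eq_prod_sq X Y n).trans (prod_sq_jacobiMonomialPairing X Y n hn)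
end

section
/- Let n ≥ 1 be an integer and let X and Y be real numbers. Then det_{0≤i,j≤2n-1}( (i − j) · (X+i+1)_j · (Y+i+j+1)_{2n−j−1} ) = ∏_{a=0}^{n-1} ((2a+1)!)^2 · (X+2a+1) · (Y+4n−2a−2) · (X−Y−2a)^{2n−2a−2} · (X−Y−2a−1)^{2n−2a−2}. -/
section JacobiSkewHankel

open Polynomial

/-! ### Pochhammer symbols -/

theorem eval_ascPochhammer_add (x : ℝ) (m k : ℕ) :
    (ascPochhammer ℝ (m + k)).eval x =
      (ascPochhammer ℝ m).eval x * (ascPochhammer ℝ k).eval (x + m) := by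
  rw [← ascPochhammer_mul]
  simp

theorem eval_ascPochhammer_one_add (x : ℝ) (k : ℕ) :
    (ascPochhammer ℝ (k + 1)).eval x = x * (ascPochhammer ℝ k).eval (x + 1) := by
  rw [add_comm k 1, eval_ascPochhammer_add]
  simp

/-! ### The Beta moment functional and first order operators -/

/-- The functional sending `X ^ s` to the moment `(a)_s / (g)_s` of the Beta distribution with
parameters `a` and `g - a`. -/
noncomputable def betaMoment (a g : ℝ) : ℝ[X] →ₗ[ℝ] ℝ :=
  Polynomial.lsum fun s =>
    ((ascPochhammer ℝ s).eval a / (ascPochhammer ℝ s).eval g) • LinearMap.id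

theorem betaMoment_X_pow (a g : ℝ) (s : ℕ) :
    betaMoment a g (X ^ s) = (ascPochhammer ℝ s).eval a / (ascPochhammer ℝ s).eval g := by
  simp [betaMoment, Polynomial.lsum_apply, Polynomial.X_pow_eq_monomial]

/-- The operator `p ↦ c X (1 - X) (derivative p) + (a - g X) p`. -/
noncomputable def ladder (c a g : ℝ) : ℝ[X] →ₗ[ℝ] ℝ[X] :=
  LinearMap.mulLeft ℝ (C c * X * (1 - X)) ∘ₗ Polynomial.derivative +
    LinearMap.mulLeft ℝ (C a - C g * X)

theorem ladder_apply (c a g : ℝ) (p : ℝ[X]) :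
    ladder c a g p = C c * X * (1 - X) * derivative p + (C a - C g * X) * p := by
  simp [ladder, mul_assoc]

theorem ladder_X_pow (c a g : ℝ) (j : ℕ) :
    ladder c a g (X ^ j) = (c * j + a) • X ^ j - (c * j + g) • X ^ (j + 1) := by
  rw [ladder_apply, derivative_X_pow]
  simp only [smul_eq_C_mul, C_add, C_mul]
  cases j with
  | zero => simp
  | succ j => simp only [Nat.add_sub_cancel]; ring

theorem coeff_ladder_succ (c a g : ℝ) (p : ℝ[X]) (k : ℕ) :
    (ladder c a g p).coeff (k + 1) =
      (c * (k + 1) + a) * p.coeff (k + 1) - (c * k + g) * p.coeff k := by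
  have h : ladder c a g p = C c * (derivative p * X) - C c * (derivative p * X * X)
      + C a * p - C g * (p * X) := by
    rw [ladder_apply]; ring
  rw [h]
  cases k with
  | zero => simp [coeff_derivative]; ring
  | succ k => simp [coeff_derivative]; ring

theorem natDegree_ladder_le (c a g : ℝ) (p : ℝ[X]) (k : ℕ) (hp : p.natDegree ≤ k) :
    (ladder c a g p).natDegree ≤ k + 1 := by
  rw [natDegree_le_iff_coeff_eq_zero]
  intro m hm
  obtain ⟨m, rfl⟩ : ∃ l, m = l + 1 := ⟨m - 1, by omega⟩
  rw [coeff_ladder_succ, coeff_eq_zero_of_natDegree_lt (by omega : p.natDegree < m + 1),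
    coeff_eq_zero_of_natDegree_lt (by omega : p.natDegree < m)]
  ring

theorem betaMoment_X_pow_mul_ladder_X_pow {a g : ℝ} (hg : 0 < g) (c : ℝ) (i j : ℕ) :
    betaMoment a g (X ^ i * ladder c a g (X ^ j)) =
      (c * j - (i + j)) * (g - a) * ((ascPochhammer ℝ (i + j)).eval a /
        (ascPochhammer ℝ (i + j + 1)).eval g) := by
  have h1 : (ascPochhammer ℝ (i + j)).eval g ≠ 0 := (ascPochhammer_pos _ _ hg).ne'
  have h2 : g + ((i + j : ℕ) : ℝ) ≠ 0 := by positivity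
  rw [ladder_X_pow, mul_sub, mul_smul_comm, mul_smul_comm, ← pow_add, ← pow_add, map_sub,
    map_smul, map_smul, ← add_assoc, betaMoment_X_pow, betaMoment_X_pow,
    ascPochhammer_succ_eval, ascPochhammer_succ_eval]
  simp only [smul_eq_mul]
  field_simp
  push_cast
  ring

theorem betaMoment_ladder_one {a g : ℝ} (hg : 0 < g) (q : ℝ[X]) :
    betaMoment a g (ladder 1 a g q) = 0 := by
  induction q using Polynomial.induction_on' with
  | add p q hp hq => rw [map_add, map_add, hp, hq, add_zero]
  | monomial j r =>
    have h := betaMoment_X_pow_mul_ladder_X_pow (a := a) hg 1 0 j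
    rw [← smul_X_eq_monomial, map_smul, map_smul]
    simp at h
    simp [h]

theorem betaMoment_X_pow_succ_mul_ladder_one {a g : ℝ} (hg : 0 < g) (i : ℕ) (q : ℝ[X]) :
    betaMoment a g (X ^ (i + 1) * ladder 1 a g q) =
      -((i + 1) * (a * (g - a) / (g * (g + 1)))) * betaMoment (a + 1) (g + 2) (X ^ i * q) := by
  induction q using Polynomial.induction_on' with
  | add p q hp hq => simp only [map_add, mul_add (X ^ _), hp, hq]; ring
  | monomial j r =>
    have h1 : (ascPochhammer ℝ (i + j)).eval (g + 2) ≠ 0 := (ascPochhammer_pos _ _ (by linarith)).ne'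
    rw [← smul_X_eq_monomial, map_smul, mul_smul_comm, map_smul, mul_smul_comm, map_smul,
      betaMoment_X_pow_mul_ladder_X_pow hg, ← pow_add, betaMoment_X_pow,
      add_right_comm i 1 j, eval_ascPochhammer_one_add a, eval_ascPochhammer_one_add g,
      eval_ascPochhammer_one_add (g + 1), show g + 1 + 1 = g + 2 by ring]
    simp only [smul_eq_mul]
    field_simp
    push_cast
    ring

/-- The bilinear form `(p, q) ↦ betaMoment (p * ladder 2 q)` is skew-symmetric. -/
theorem betaMoment_mul_ladder_two_skew {a g : ℝ} (hg : 0 < g) (p q : ℝ[X]) :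
    betaMoment a g (p * ladder 2 a g q) = -betaMoment a g (q * ladder 2 a g p) := by
  induction p using Polynomial.induction_on' with
  | add p₁ p₂ h₁ h₂ => rw [add_mul, map_add, h₁, h₂, map_add, mul_add, map_add, neg_add]
  | monomial i r =>
    induction q using Polynomial.induction_on' with
    | add q₁ q₂ h₁ h₂ => rw [add_mul, map_add, map_add, mul_add, map_add, h₁, h₂, neg_add]
    | monomial j t =>
      simp only [← smul_X_eq_monomial, map_smul, mul_smul_comm, smul_mul_assoc,
        betaMoment_X_pow_mul_ladder_X_pow hg, add_comm j i, smul_eq_mul]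
      ring

/-! ### Jacobi polynomials via the Rodrigues formula -/

/-- The (unnormalised) Jacobi polynomials orthogonal with respect to `betaMoment a g`. -/
noncomputable def jacobiPoly : ℕ → ℝ → ℝ → ℝ[X]
  | 0, _, _ => 1
  | k + 1, a, g => ladder 1 a g (jacobiPoly k (a + 1) (g + 2))

theorem natDegree_jacobiPoly_le (k : ℕ) (a g : ℝ) : (jacobiPoly k a g).natDegree ≤ k := by
  induction k generalizing a g with
  | zero => simp [jacobiPoly]
  | succ k ih => exact natDegree_ladder_le _ _ _ _ _ (ih _ _)

theorem coeff_jacobiPoly_self (k : ℕ) (a g : ℝ) :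
    (jacobiPoly k a g).coeff k = (-1) ^ k * (ascPochhammer ℝ k).eval (g + k - 1) := by
  induction k generalizing a g with
  | zero => simp [jacobiPoly]
  | succ k ih =>
    rw [jacobiPoly, coeff_ladder_succ, ih, coeff_eq_zero_of_natDegree_lt
      ((natDegree_jacobiPoly_le k _ _).trans_lt k.lt_succ_self), eval_ascPochhammer_one_add,
      show g + ((k + 1 : ℕ) : ℝ) - 1 + 1 = g + 2 + k - 1 by push_cast; ring]
    push_cast
    ring

theorem betaMoment_X_pow_mul_jacobiPoly_of_lt {i k : ℕ} (h : i < k) {a g : ℝ} (hg : 0 < g) :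
    betaMoment a g (X ^ i * jacobiPoly k a g) = 0 := by
  induction k generalizing a g i with
  | zero => omega
  | succ k ih =>
    cases i with
    | zero => rw [pow_zero, one_mul, jacobiPoly, betaMoment_ladder_one hg]
    | succ i =>
      rw [jacobiPoly, betaMoment_X_pow_succ_mul_ladder_one hg, ih (by omega) (by linarith),
        mul_zero]

theorem betaMoment_X_pow_mul_jacobiPoly_self (k : ℕ) {a g : ℝ} (hg : 0 < g) :
    betaMoment a g (X ^ k * jacobiPoly k a g) =
      (-1) ^ k * k.factorial * (ascPochhammer ℝ k).eval a * (ascPochhammer ℝ k).eval (g - a) /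
        (ascPochhammer ℝ (2 * k)).eval g := by
  induction k generalizing a g with
  | zero =>
    have h := betaMoment_X_pow a g 0
    simpa [jacobiPoly] using h
  | succ k ih =>
    have h1 : (ascPochhammer ℝ (2 * k)).eval (g + 2) ≠ 0 :=
      (ascPochhammer_pos _ _ (by linarith)).ne'
    rw [jacobiPoly, betaMoment_X_pow_succ_mul_ladder_one hg, ih (by linarith),
      eval_ascPochhammer_one_add a, eval_ascPochhammer_one_add (g - a),
      show 2 * (k + 1) = 2 * k + 1 + 1 by ring, eval_ascPochhammer_one_add g,
      eval_ascPochhammer_one_add (g + 1), show g + 1 + 1 = g + 2 by ring,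
      show g + 2 - (a + 1) = g - a + 1 by ring, Nat.factorial_succ]
    field_simp
    push_cast
    ring

theorem betaMoment_mul_jacobiPoly {k : ℕ} {p : ℝ[X]} (hp : p.natDegree ≤ k) {a g : ℝ}
    (hg : 0 < g) :
    betaMoment a g (p * jacobiPoly k a g) =
      p.coeff k * betaMoment a g (X ^ k * jacobiPoly k a g) := by
  have h : p * jacobiPoly k a g =
      ∑ i ∈ Finset.range (k + 1), p.coeff i • (X ^ i * jacobiPoly k a g) := by
    conv_lhs => rw [p.as_sum_range' (k + 1) (by omega), Finset.sum_mul]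
    exact Finset.sum_congr rfl fun i _ => by rw [← smul_X_eq_monomial, smul_mul_assoc]
  rw [h, map_sum, Finset.sum_range_succ, Finset.sum_eq_zero, zero_add, map_smul, smul_eq_mul]
  intro i hi
  rw [map_smul, betaMoment_X_pow_mul_jacobiPoly_of_lt (Finset.mem_range.mp hi) hg, smul_zero]

theorem betaMoment_jacobiPoly_mul_ladder_two_of_lt {k l : ℕ} (h : l + 1 < k) {a g : ℝ}
    (hg : 0 < g) :
    betaMoment a g (jacobiPoly k a g * ladder 2 a g (jacobiPoly l a g)) = 0 := by
  have hd := natDegree_ladder_le 2 a g _ l (natDegree_jacobiPoly_le l a g)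
  rw [mul_comm, betaMoment_mul_jacobiPoly (by omega) hg,
    coeff_eq_zero_of_natDegree_lt (by omega), zero_mul]

theorem betaMoment_jacobiPoly_succ_mul_ladder_two (k : ℕ) {a g : ℝ} (hg : 0 < g) :
    betaMoment a g (jacobiPoly (k + 1) a g * ladder 2 a g (jacobiPoly k a g)) =
      -(2 * k + g) * (jacobiPoly k a g).coeff k *
        betaMoment a g (X ^ (k + 1) * jacobiPoly (k + 1) a g) := by
  rw [mul_comm (jacobiPoly _ _ _), betaMoment_mul_jacobiPoly
    (natDegree_ladder_le 2 a g _ k (natDegree_jacobiPoly_le k a g)) hg, coeff_ladder_succ,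
    coeff_eq_zero_of_natDegree_lt ((natDegree_jacobiPoly_le k a g).trans_lt k.lt_succ_self)]
  ring

/-! ### Determinants -/

theorem det_skew_tridiagonal (n : ℕ) (T : ℕ → ℕ → ℝ) (hskew : ∀ i j, T i j = -T j i)
    (htri : ∀ i j, j + 1 < i → T i j = 0) :
    Matrix.det (Matrix.of fun i j : Fin (2 * n) => T i j) =
      ∏ k ∈ Finset.range n, T (2 * k + 1) (2 * k) ^ 2 := by
  induction n generalizing T with
  | zero => simp
  | succ n ih =>
    have hdiag : T 0 0 = 0 := by linarith [hskew 0 0]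
    have htri' : ∀ i j, i + 1 < j → T i j = 0 := fun i j h => by
      rw [hskew, htri j i h, neg_zero]
    have hsub : ((Matrix.of fun i j : Fin (2 * n + 1 + 1) => T i j).submatrix Fin.succ
        (Fin.succAbove 1)).det = T 1 0 * (Matrix.of fun i j : Fin (2 * n) =>
          T (i + 2) (j + 2)).det := by
      rw [Matrix.det_succ_column_zero, Fin.sum_univ_succ, Finset.sum_eq_zero, add_zero]
      · have hs : (((Matrix.of fun i j : Fin (2 * n + 1 + 1) => T i j).submatrix Fin.succ
            (Fin.succAbove 1)).submatrix (Fin.succAbove 0) Fin.succ) =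
            Matrix.of fun i j : Fin (2 * n) => T (i + 2) (j + 2) := by
          ext i j
          simp [Fin.succAbove, Fin.lt_def]
        rw [hs]
        simp
      · intro i _
        simp [htri ((i : ℕ) + 1 + 1) 0 (by omega)]
    have hm : ∀ k : ℕ, T (2 * k + 1 + 2) (2 * k + 2) = T (2 * (k + 1) + 1) (2 * (k + 1)) :=
      fun k => by ring_nf
    have h := ih (fun i j => T (i + 2) (j + 2)) (fun i j => hskew _ _)
      (fun i j hij => htri _ _ (by omega))
    simp only [hm] at h
    rw [Finset.prod_range_succ', ← h, show 2 * (n + 1) = 2 * n + 1 + 1 by ring,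
      Matrix.det_succ_row_zero, Fin.sum_univ_succ, Fin.sum_univ_succ, Finset.sum_eq_zero,
      Fin.succ_zero_eq_one, hsub]
    · simp [hdiag, hskew 0 1]
      ring
    · intro i _
      simp [htri' 0 ((i : ℕ) + 1 + 1) (by omega)]

/-- Congruence by the coefficient matrix of a family of polynomials of degree less than `N`. -/
theorem coeffMatrix_mul_gram_mul_transpose (N : ℕ) (B : ℝ[X] →ₗ[ℝ] ℝ[X] →ₗ[ℝ] ℝ) (P : ℕ → ℝ[X])
    (hP : ∀ k, (P k).natDegree ≤ k) :
    (Matrix.of fun k i : Fin N => (P k).coeff i) *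
        (Matrix.of fun i j : Fin N => B (X ^ (i : ℕ)) (X ^ (j : ℕ))) *
        (Matrix.of fun k i : Fin N => (P k).coeff i).transpose =
      Matrix.of fun k l : Fin N => B (P k) (P l) := by
  have hsum : ∀ k : Fin N, P k = ∑ i : Fin N, (P k).coeff i • X ^ (i : ℕ) := fun k => by
    conv_lhs => rw [(P k).as_sum_range' N ((hP k).trans_lt k.2), ← Fin.sum_univ_eq_sum_range
      (fun i => monomial i ((P k).coeff i))]
    simp only [smul_X_eq_monomial]
  ext k l
  conv_rhs => rw [Matrix.of_apply, hsum k, hsum l]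
  simp only [Matrix.mul_apply, Matrix.transpose_apply, Matrix.of_apply, map_sum, map_smul,
    LinearMap.sum_apply, LinearMap.smul_apply, smul_eq_mul, Finset.sum_mul, Finset.mul_sum]
  exact Finset.sum_congr rfl fun i _ => Finset.sum_congr rfl fun j _ => by ring

theorem det_gram_ladder_two (n : ℕ) {a g : ℝ} (hg : 0 < g) :
    (∏ k ∈ Finset.range (2 * n), (jacobiPoly k a g).coeff k) ^ 2 *
        (Matrix.of fun i j : Fin (2 * n) =>
          betaMoment a g (X ^ (i : ℕ) * ladder 2 a g (X ^ (j : ℕ)))).det =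
      ∏ k ∈ Finset.range n, betaMoment a g
        (jacobiPoly (2 * k + 1) a g * ladder 2 a g (jacobiPoly (2 * k) a g)) ^ 2 := by
  have hV : (Matrix.of fun k i : Fin (2 * n) => (jacobiPoly k a g).coeff i).det =
      ∏ k ∈ Finset.range (2 * n), (jacobiPoly k a g).coeff k := by
    rw [Matrix.det_of_isLowerTriangular, ← Fin.prod_univ_eq_prod_range
      (fun k => (jacobiPoly k a g).coeff k)]
    · rfl
    · intro k i hki
      exact coeff_eq_zero_of_natDegree_lt ((natDegree_jacobiPoly_le k a g).trans_lt hki)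
  have h := congrArg Matrix.det (coeffMatrix_mul_gram_mul_transpose (2 * n)
    (((LinearMap.mul ℝ ℝ[X]).compl₂ (ladder 2 a g)).compr₂ (betaMoment a g))
    (fun k => jacobiPoly k a g) fun k => natDegree_jacobiPoly_le k a g)
  rw [Matrix.det_mul, Matrix.det_mul, Matrix.det_transpose, hV] at h
  simp only [LinearMap.compr₂_apply, LinearMap.compl₂_apply, LinearMap.mul_apply'] at h
  rw [det_skew_tridiagonal n (fun k l => betaMoment a g
    (jacobiPoly k a g * ladder 2 a g (jacobiPoly l a g)))
    (fun _ _ => betaMoment_mul_ladder_two_skew hg _ _)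
    (fun _ _ hij => betaMoment_jacobiPoly_mul_ladder_two_of_lt hij hg)] at h
  rw [← h]
  ring

/-! ### The product side -/

theorem prod_falling_sq (d : ℝ) (n : ℕ) :
    (d * ∏ b ∈ Finset.range n, (-1 - d - 2 * b) * (-1 - d - 2 * b - 1)) =
      (ascPochhammer ℝ (2 * n + 1)).eval d := by
  induction n with
  | zero => simp
  | succ n ih =>
    rw [Finset.prod_range_succ, ← mul_assoc, ih, show 2 * (n + 1) + 1 = 2 * n + 1 + 1 + 1 by ring,
      ascPochhammer_succ_eval (2 * n + 1 + 1), ascPochhammer_succ_eval (2 * n + 1)]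
    push_cast
    ring

theorem prod_even_shift_succ (y : ℝ) (n : ℕ) :
    (∏ b ∈ Finset.range (n + 1), (y + 4 * (n + 1 : ℕ) - 2 * b - 2)) * (y + 2 * n) =
      (∏ b ∈ Finset.range n, (y + 4 * n - 2 * b - 2)) * ((y + 4 * n) * (y + 4 * n + 2)) := by
  rw [Finset.prod_range_succ', Finset.prod_congr rfl (g := fun b : ℕ => y + 4 * n - 2 * b)]
  · have h := (Finset.prod_range_succ (fun b : ℕ => y + 4 * n - 2 * b) n).symm.trans
      (Finset.prod_range_succ' (fun b : ℕ => y + 4 * n - 2 * b) n)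
    have h' : ∀ b : ℕ, y + 4 * n - 2 * (b + 1 : ℕ) = y + 4 * n - 2 * b - 2 := fun b => by
      push_cast; ring
    simp only [h'] at h
    push_cast at h ⊢
    linear_combination (y + 4 * n + 2) * h
  · intro b _
    push_cast
    ring

theorem prod_pow_sub_succ (w : ℕ → ℝ) (n : ℕ) :
    ∏ b ∈ Finset.range (n + 1), w b ^ (2 * (n + 1) - 2 * b - 2) =
      (∏ b ∈ Finset.range n, w b ^ (2 * n - 2 * b - 2)) * (∏ b ∈ Finset.range n, w b) ^ 2 := by
  rw [Finset.prod_range_succ, show 2 * (n + 1) - 2 * n - 2 = 0 by omega, pow_zero, mul_one,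
    ← Finset.prod_pow, ← Finset.prod_mul_distrib]
  refine Finset.prod_congr rfl fun b hb => ?_
  have := Finset.mem_range.mp hb
  rw [← pow_add]
  congr 1
  omega

/-- The product evaluating the determinant of the row-scaled skew-symmetric Hankel matrix. -/
noncomputable def jacobiPfaffianSq (n : ℕ) (x y : ℝ) : ℝ :=
  ∏ b ∈ Finset.range n,
    ((2 * b + 1).factorial : ℝ) ^ 2 * (x + 2 * b + 1) *
      (y + 4 * n - 2 * b - 2) *
      (x - y - 2 * b) ^ (2 * n - 2 * b - 2) *
      (x - y - 2 * b - 1) ^ (2 * n - 2 * b - 2)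

theorem jacobiPfaffianSq_succ (n : ℕ) (x y : ℝ) :
    jacobiPfaffianSq (n + 1) x y * (y - x - 1) ^ 2 * (y + 2 * n) =
      jacobiPfaffianSq n x y * (((2 * n + 1).factorial : ℝ) ^ 2 * (x + 2 * n + 1) *
        ((y + 4 * n) * (y + 4 * n + 2)) *
        (ascPochhammer ℝ (2 * n + 1)).eval (y - x - 1) ^ 2) := by
  have h1 := prod_even_shift_succ y n
  have h2 := prod_falling_sq (y - x - 1) n
  simp only [show -1 - (y - x - 1) = x - y by ring] at h2
  simp only [jacobiPfaffianSq, Finset.prod_mul_distrib] at h1 h2 ⊢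
  rw [prod_pow_sub_succ (fun b => x - y - 2 * b), prod_pow_sub_succ (fun b => x - y - 2 * b - 1),
    Finset.prod_range_succ (fun b : ℕ => ((2 * b + 1).factorial : ℝ) ^ 2),
    Finset.prod_range_succ (fun b : ℕ => x + 2 * b + 1), ← h2]
  linear_combination (∏ b ∈ Finset.range n, ((2 * b + 1).factorial : ℝ) ^ 2) *
    ((2 * n + 1).factorial : ℝ) ^ 2 * (∏ b ∈ Finset.range n, (x + 2 * b + 1)) *
    (x + 2 * n + 1) * (∏ b ∈ Finset.range n, (x - y - 2 * b) ^ (2 * n - 2 * b - 2)) *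
    (∏ b ∈ Finset.range n, (x - y - 2 * b - 1) ^ (2 * n - 2 * b - 2)) *
    (∏ b ∈ Finset.range n, (x - y - 2 * b)) ^ 2 *
    (∏ b ∈ Finset.range n, (x - y - 2 * b - 1)) ^ 2 * (y - x - 1) ^ 2 * h1

theorem jacobiPfaffianSq_mul {a g : ℝ} (ha : 0 < a) (hag : a < g) (n : ℕ) :
    jacobiPfaffianSq n (a - 1) g * (∏ k ∈ Finset.range (2 * n), (jacobiPoly k a g).coeff k) ^ 2 *
        (∏ i ∈ Finset.range (2 * n), (ascPochhammer ℝ i).eval g) *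
        ((g - a) ^ (2 * n) * ∏ i ∈ Finset.range (2 * n), (ascPochhammer ℝ i).eval a) =
      (∏ i ∈ Finset.range (4 * n), (ascPochhammer ℝ i).eval g) *
        ∏ k ∈ Finset.range n, betaMoment a g
          (jacobiPoly (2 * k + 1) a g * ladder 2 a g (jacobiPoly (2 * k) a g)) ^ 2 := by
  have hg : 0 < g := ha.trans hag
  induction n with
  | zero => simp [jacobiPfaffianSq]
  | succ n ih =>
    have hR := jacobiPfaffianSq_succ n (a - 1) g
    rw [show g - (a - 1) - 1 = g - a by ring, show a - 1 + 2 * n + 1 = a + 2 * n by ring] at hR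
    have hd : g - a ≠ 0 := by linarith
    have hg2 : g + 2 * n ≠ 0 := by positivity
    have hg4 : g + 4 * n ≠ 0 := by positivity
    have hg41 : g + 4 * n + 1 ≠ 0 := by positivity
    have hg42 : g + 4 * n + 2 ≠ 0 := by positivity
    have hp2 : (ascPochhammer ℝ (2 * n)).eval g ≠ 0 := (ascPochhammer_pos _ _ hg).ne'
    have hp4 : (ascPochhammer ℝ (4 * n)).eval g ≠ 0 := (ascPochhammer_pos _ _ hg).ne'
    have hpa : (ascPochhammer ℝ (2 * n)).eval a ≠ 0 := (ascPochhammer_pos _ _ ha).ne'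
    have e1 : (ascPochhammer ℝ (4 * n + 1)).eval g =
        (ascPochhammer ℝ (4 * n)).eval g * (g + 4 * n) := by
      rw [ascPochhammer_succ_eval]; push_cast; ring
    have e2 : (ascPochhammer ℝ (4 * n + 2)).eval g =
        (ascPochhammer ℝ (4 * n)).eval g * (g + 4 * n) * (g + 4 * n + 1) := by
      rw [ascPochhammer_succ_eval, e1]; push_cast; ring
    have e3 : (ascPochhammer ℝ (4 * n + 3)).eval g =
        (ascPochhammer ℝ (4 * n)).eval g * (g + 4 * n) * (g + 4 * n + 1) * (g + 4 * n + 2) := by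
      rw [ascPochhammer_succ_eval, e2]; push_cast; ring
    have e4 : (ascPochhammer ℝ (2 * n + 1)).eval g =
        (ascPochhammer ℝ (2 * n)).eval g * (g + 2 * n) := by
      rw [ascPochhammer_succ_eval]; push_cast; ring
    have e5 : (ascPochhammer ℝ (2 * n + 1)).eval a =
        (ascPochhammer ℝ (2 * n)).eval a * (a + 2 * n) := by
      rw [ascPochhammer_succ_eval]; push_cast; ring
    have e6 : (ascPochhammer ℝ (2 * n + 1)).eval (g + 2 * n) =
        (ascPochhammer ℝ (4 * n)).eval g * (g + 4 * n) / (ascPochhammer ℝ (2 * n)).eval g := by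
      rw [← e1, show 4 * n + 1 = 2 * n + (2 * n + 1) by ring, eval_ascPochhammer_add g]
      push_cast
      field_simp
    have ev : (jacobiPoly (2 * n + 1) a g).coeff (2 * n + 1) =
        -((ascPochhammer ℝ (4 * n)).eval g * (g + 4 * n) / (ascPochhammer ℝ (2 * n)).eval g) := by
      rw [coeff_jacobiPoly_self, ← e6, pow_succ, pow_mul]
      push_cast
      rw [show g + (2 * n + 1) - 1 = g + 2 * (n : ℝ) by ring]
      simp
    have eT := betaMoment_jacobiPoly_succ_mul_ladder_two (2 * n) (a := a) hg
    rw [betaMoment_X_pow_mul_jacobiPoly_self _ hg, e5, show 2 * (2 * n + 1) = 4 * n + 2 by ring,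
      e2, pow_succ, pow_mul] at eT
    have hR' : jacobiPfaffianSq (n + 1) (a - 1) g =
        jacobiPfaffianSq n (a - 1) g * (((2 * n + 1).factorial : ℝ) ^ 2 * (a + 2 * n) *
        ((g + 4 * n) * (g + 4 * n + 2)) *
        (ascPochhammer ℝ (2 * n + 1)).eval (g - a) ^ 2) / ((g - a) ^ 2 * (g + 2 * n)) := by
      rw [← hR]; field_simp
    rw [show 2 * (n + 1) = 2 * n + 1 + 1 by ring, show 4 * (n + 1) = 4 * n + 3 + 1 by ring]
    simp only [Finset.prod_range_succ _ (4 * n + 3), Finset.prod_range_succ _ (4 * n + 2),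
      Finset.prod_range_succ _ (4 * n + 1), Finset.prod_range_succ _ (4 * n),
      Finset.prod_range_succ _ (2 * n + 1), Finset.prod_range_succ _ (2 * n),
      Finset.prod_range_succ _ n]
    rw [hR', eT, ev, e1, e2, e3, e4, e5]
    generalize (∏ k ∈ Finset.range (2 * n), (jacobiPoly k a g).coeff k) = V at *
    generalize (∏ k ∈ Finset.range n, betaMoment a g
      (jacobiPoly (2 * k + 1) a g * ladder 2 a g (jacobiPoly (2 * k) a g)) ^ 2) = W at *
    generalize (jacobiPoly (2 * n) a g).coeff (2 * n) = v at *
    generalize (∏ i ∈ Finset.range (2 * n), (ascPochhammer ℝ i).eval g) = G at *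
    generalize (∏ i ∈ Finset.range (4 * n), (ascPochhammer ℝ i).eval g) = H at *
    generalize (∏ i ∈ Finset.range (2 * n), (ascPochhammer ℝ i).eval a) = A at *
    generalize (ascPochhammer ℝ (2 * n + 1)).eval (g - a) = D at *
    generalize (ascPochhammer ℝ (2 * n)).eval g = p at *
    generalize (ascPochhammer ℝ (4 * n)).eval g = q at *
    generalize (ascPochhammer ℝ (2 * n)).eval a = s at *
    generalize jacobiPfaffianSq n (a - 1) g = R at *
    generalize ((2 * n + 1).factorial : ℝ) = F at *
    have key := congrArg (· * ((F ^ 2 * (a + 2 * n) * ((g + 4 * n) * (g + 4 * n + 2)) * D ^ 2) /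
      ((g - a) ^ 2 * (g + 2 * n)) * (v * (q * (g + 4 * n) / p)) ^ 2 * (p * (p * (g + 2 * n))) *
      ((g - a) ^ 2 * (s * (s * (a + 2 * n)))))) ih
    refine Eq.trans ?_ (key.trans ?_)
    · ring
    · have e : ((-1 : ℝ) ^ 2) ^ n = 1 := by simp
      push_cast
      rw [e]
      field_simp
      ring

theorem det_eq_jacobiPfaffianSq_of_lt {x y : ℝ} (hx : -1 < x) (hxy : x + 1 < y) (n : ℕ) :
    Matrix.det (Matrix.of fun i j : Fin (2 * n) =>
      ((i.val : ℝ) - (j.val : ℝ)) *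
        (ascPochhammer ℝ j.val).eval (x + i.val + 1) *
        (ascPochhammer ℝ (2 * n - j.val - 1)).eval (y + i.val + j.val + 1)) =
      jacobiPfaffianSq n x y := by
  obtain ⟨a, rfl⟩ : ∃ a, x = a - 1 := ⟨x + 1, by ring⟩
  have ha : 0 < a := by linarith
  have hag : a < y := by linarith
  have hy : 0 < y := ha.trans hag
  have hd : y - a ≠ 0 := by linarith
  have hM : (Matrix.of fun i j : Fin (2 * n) =>
      ((i.val : ℝ) - (j.val : ℝ)) *
        (ascPochhammer ℝ j.val).eval (a - 1 + i.val + 1) *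
        (ascPochhammer ℝ (2 * n - j.val - 1)).eval (y + i.val + j.val + 1)) =
      Matrix.of fun i j : Fin (2 * n) => -((ascPochhammer ℝ (2 * n + i.val)).eval y /
        ((y - a) * (ascPochhammer ℝ i.val).eval a)) * (Matrix.of fun i j : Fin (2 * n) =>
          betaMoment a y (X ^ (i : ℕ) * ladder 2 a y (X ^ (j : ℕ)))) i j := by
    ext i j
    have h1 : (ascPochhammer ℝ (i + j + 1 : ℕ)).eval y ≠ 0 := (ascPochhammer_pos _ _ hy).ne'
    have h2 : (ascPochhammer ℝ (i : ℕ)).eval a ≠ 0 := (ascPochhammer_pos _ _ ha).ne'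
    simp only [Matrix.of_apply]
    rw [betaMoment_X_pow_mul_ladder_X_pow hy,
      show 2 * n + i.val = (i + j + 1 : ℕ) + (2 * n - j - 1) by omega, eval_ascPochhammer_add y,
      eval_ascPochhammer_add a i j, show a - 1 + (i.val : ℝ) + 1 = a + i.val by ring]
    push_cast
    rw [show y + (i.val : ℝ) + j.val + 1 = y + (i.val + j.val + 1) by ring]
    field_simp
    ring
  have hV : (∏ k ∈ Finset.range (2 * n), (jacobiPoly k a y).coeff k) ≠ 0 := by
    refine Finset.prod_ne_zero_iff.mpr fun k _ => ?_
    rw [coeff_jacobiPoly_self]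
    refine mul_ne_zero (by simp) ?_
    cases k with
    | zero => simp
    | succ k => exact (ascPochhammer_pos _ _ (by push_cast; linarith [k.cast_nonneg (α := ℝ)])).ne'
  have hG : (∏ i ∈ Finset.range (2 * n), (ascPochhammer ℝ i).eval y) ≠ 0 :=
    Finset.prod_ne_zero_iff.mpr fun k _ => (ascPochhammer_pos _ _ hy).ne'
  have hA : (∏ i ∈ Finset.range (2 * n), (ascPochhammer ℝ i).eval a) ≠ 0 :=
    Finset.prod_ne_zero_iff.mpr fun k _ => (ascPochhammer_pos _ _ ha).ne'
  have hrow : ∏ i : Fin (2 * n), -((ascPochhammer ℝ (2 * n + i.val)).eval y /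
        ((y - a) * (ascPochhammer ℝ i.val).eval a)) =
      (∏ i ∈ Finset.range (2 * n), (ascPochhammer ℝ (2 * n + i)).eval y) /
        ((y - a) ^ (2 * n) * ∏ i ∈ Finset.range (2 * n), (ascPochhammer ℝ i).eval a) := by
    rw [Fin.prod_univ_eq_prod_range (fun i => -((ascPochhammer ℝ (2 * n + i)).eval y /
        ((y - a) * (ascPochhammer ℝ i).eval a))), Finset.prod_neg, Finset.prod_div_distrib,
      Finset.prod_mul_distrib]
    simp
  have h1 := det_gram_ladder_two n (a := a) hy
  have h2 := jacobiPfaffianSq_mul ha hag n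
  rw [← h1, show 4 * n = 2 * n + 2 * n by ring, Finset.prod_range_add] at h2
  rw [hM, Matrix.det_mul_column, hrow, div_mul_eq_mul_div, div_eq_iff (by positivity)]
  refine mul_right_cancel₀ (mul_ne_zero (pow_ne_zero 2 hV) hG) ?_
  linear_combination -h2

end JacobiSkewHankel

/-- The key determinant evaluation (3.6) in the proof of Theorem 6 of Krattenthaler:
`det ((i - j) (X+i+1)_j (Y+i+j+1)_{2n-j-1})` for real `X`, `Y`, where `(α)_m` is the
Pochhammer symbol (rising factorial). -/
theorem stmt_7 (n : ℕ) (hn : 1 ≤ n) (X Y : ℝ) :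
    Matrix.det (Matrix.of fun i j : Fin (2 * n) =>
      ((i.val : ℝ) - (j.val : ℝ)) *
        (ascPochhammer ℝ j.val).eval (X + i.val + 1) *
        (ascPochhammer ℝ (2 * n - j.val - 1)).eval (Y + i.val + j.val + 1)) =
      ∏ a ∈ Finset.range n,
        ((2 * a + 1).factorial : ℝ) ^ 2 * (X + 2 * a + 1) *
          (Y + 4 * n - 2 * a - 2) *
          (X - Y - 2 * a) ^ (2 * n - 2 * a - 2) *
          (X - Y - 2 * a - 1) ^ (2 * n - 2 * a - 2) := by
  -- Both sides are polynomial along the line `t ↦ (X + t, Y + 2 t)` and agree for large `t`.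
  let M : Matrix (Fin (2 * n)) (Fin (2 * n)) (Polynomial ℝ) := Matrix.of fun i j =>
    (Polynomial.C ((i.val : ℝ) - (j.val : ℝ))) *
      (ascPochhammer ℝ j.val).comp (Polynomial.X + Polynomial.C (X + i.val + 1)) *
      (ascPochhammer ℝ (2 * n - j.val - 1)).comp
        (2 * Polynomial.X + Polynomial.C (Y + i.val + j.val + 1))
  let R : Polynomial ℝ := ∏ a ∈ Finset.range n,
    Polynomial.C (((2 * a + 1).factorial : ℝ) ^ 2) *
      (Polynomial.X + Polynomial.C (X + 2 * a + 1)) *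
      (2 * Polynomial.X + Polynomial.C (Y + 4 * n - 2 * a - 2)) *
      (Polynomial.C (X - Y - 2 * a) - Polynomial.X) ^ (2 * n - 2 * a - 2) *
      (Polynomial.C (X - Y - 2 * a - 1) - Polynomial.X) ^ (2 * n - 2 * a - 2)
  have hM : ∀ t : ℝ, M.det.eval t = Matrix.det (Matrix.of fun i j : Fin (2 * n) =>
      ((i.val : ℝ) - (j.val : ℝ)) *
        (ascPochhammer ℝ j.val).eval (X + t + i.val + 1) *
        (ascPochhammer ℝ (2 * n - j.val - 1)).eval (Y + 2 * t + i.val + j.val + 1)) := by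
    intro t
    rw [← Polynomial.coe_evalRingHom, RingHom.map_det]
    congr 1
    ext i j
    simp only [M, RingHom.mapMatrix_apply, Matrix.map_apply, Matrix.of_apply,
      Polynomial.coe_evalRingHom, Polynomial.eval_mul, Polynomial.eval_comp, Polynomial.eval_add,
      Polynomial.eval_X, Polynomial.eval_C, Polynomial.eval_ofNat]
    ring_nf
  have hR : ∀ t : ℝ, R.eval t = jacobiPfaffianSq n (X + t) (Y + 2 * t) := by
    intro t
    simp only [R, jacobiPfaffianSq, Polynomial.eval_prod]
    refine Finset.prod_congr rfl fun a _ => ?_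
    simp only [Polynomial.eval_mul, Polynomial.eval_add, Polynomial.eval_sub, Polynomial.eval_pow,
      Polynomial.eval_X, Polynomial.eval_C, Polynomial.eval_ofNat]
    ring_nf
  have hMR : M.det = R := by
    refine Polynomial.eq_of_infinite_eval_eq _ _
      ((Set.Ioi_infinite (max (-1 - X) (X + 1 - Y))).mono fun t ht => ?_)
    obtain ⟨h1, h2⟩ := max_lt_iff.mp (Set.mem_Ioi.mp ht)
    rw [Set.mem_ofPred_eq, hM, hR]
    exact det_eq_jacobiPfaffianSq_of_lt (by linarith) (by linarith) n
  have h0 := hM 0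
  rw [hMR, hR] at h0
  simpa only [mul_zero, add_zero, jacobiPfaffianSq] using h0.symm
end

section
/- Let a, i, j be nonnegative integers with i ≤ j. Then, as an identity of rational numbers, Σ_{k=0}^{j} (−1)^{j−k} · binom(j,k) · (1 + a + 2k) · (a + 2i + 2k)! / ( i! · (1 + a + i + 2k)! ) equals 2^i if i = j, and equals 0 if i < j. -/
open Polynomial in
/-- The factorial quotient is a polynomial in `k` of degree `i` with leading coefficient `2 ^ i`. -/
theorem exists_polynomial_eval_eq_factorial_div (a i : ℕ) :
    ∃ P : ℚ[X], P.natDegree = i ∧ P.leadingCoeff = 2 ^ i ∧ ∀ k : ℕ,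
      P.eval (k : ℚ) = ((1 : ℚ) + a + 2 * k) * ((a + 2 * i + 2 * k).factorial : ℚ) /
        ((1 + a + i + 2 * k).factorial : ℚ) := by
  have h2 : (2 : ℚ) ≠ 0 := two_ne_zero
  cases i with
  | zero =>
    refine ⟨1, by simp, by simp, fun k => ?_⟩
    have hf : 1 + a + 0 + 2 * k = (a + 2 * 0 + 2 * k) + 1 := by ring
    rw [hf, Nat.factorial_succ, eval_one, eq_div_iff (by positivity)]
    push_cast
    ring
  | succ m =>
    have hdeg (c : ℚ) : (C 2 * X + C c).natDegree = 1 := natDegree_linear h2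
    have hlead (c : ℚ) : (C 2 * X + C c).leadingCoeff = 2 := leadingCoeff_linear h2
    have hmonic := monic_ascPochhammer ℚ m
    have hc : ((ascPochhammer ℚ m).comp (C 2 * X + C (a + m + 3 : ℚ))).leadingCoeff = 2 ^ m := by
      rw [leadingCoeff_comp (by rw [hdeg]; exact one_ne_zero), hmonic.leadingCoeff, hlead, ascPochhammer_natDegree,
        one_mul]
    refine ⟨(C 2 * X + C (a + 1 : ℚ)) *
      (ascPochhammer ℚ m).comp (C 2 * X + C (a + m + 3 : ℚ)), ?_, ?_, fun k => ?_⟩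
    · rw [natDegree_mul', natDegree_comp, hdeg, hdeg, ascPochhammer_natDegree]
      · ring
      · rw [hlead, hc]
        positivity
    · rw [leadingCoeff_mul, hlead, hc, pow_succ']
    · have hfac := Nat.factorial_mul_ascFactorial (1 + a + (m + 1) + 2 * k) m
      rw [show 1 + a + (m + 1) + 2 * k + m = a + 2 * (m + 1) + 2 * k by ring] at hfac
      have hcast : (2 : ℚ) * k + (a + m + 3) = ((1 + a + (m + 1) + 2 * k + 1 : ℕ) : ℚ) := by
        push_cast
        ring
      rw [← hfac, eq_div_iff (by positivity)]
      simp only [eval_mul, eval_comp, eval_add, eval_C, eval_X]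
      rw [hcast, ← Nat.cast_ascFactorial]
      push_cast
      ring

/-- The entries of `M · U` in the proof of Theorem 4 of Krattenthaler: for `i ≤ j`,
the binomial sum equals `2^i` when `i = j` and `0` when `i < j`. -/
theorem stmt_8 (a i j : ℕ) (hij : i ≤ j) :
    (∑ k ∈ Finset.range (j + 1),
      (-1 : ℚ) ^ (j - k) * (j.choose k : ℚ) * ((1 : ℚ) + a + 2 * k) *
        ((a + 2 * i + 2 * k).factorial : ℚ) /
        ((i.factorial : ℚ) * ((1 + a + i + 2 * k).factorial : ℚ))) =
      if i = j then 2 ^ i else 0 := by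
  obtain ⟨P, hdeg, hlead, heval⟩ := exists_polynomial_eval_eq_factorial_div a i
  have hi : (i.factorial : ℚ) ≠ 0 := by positivity
  have hsum : (∑ k ∈ Finset.range (j + 1),
      (-1 : ℚ) ^ (j - k) * (j.choose k : ℚ) * ((1 : ℚ) + a + 2 * k) *
        ((a + 2 * i + 2 * k).factorial : ℚ) /
        ((i.factorial : ℚ) * ((1 + a + i + 2 * k).factorial : ℚ))) =
      (fwdDiff 1)^[j] (fun x => P.eval x) 0 / i.factorial := by
    rw [fwdDiff_iter_eq_sum_shift, Finset.sum_div]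
    refine Finset.sum_congr rfl fun k _ => ?_
    simp only [zero_add, nsmul_eq_mul, mul_one, heval, zsmul_eq_mul]
    push_cast
    field_simp
  rw [hsum]
  split_ifs with h
  · subst h
    have hd := congrFun P.fwdDiff_iter_degree_eq_factorial 0
    rw [hdeg, hlead] at hd
    rw [hd]
    simp [hi]
  · have hd := congrFun (Polynomial.fwdDiff_iter_eq_zero_of_degree_lt
      (hdeg.trans_lt (lt_of_le_of_ne hij h))) 0
    rw [hd]
    simp
end

section
/- Let a, i, j be nonnegative integers with i ≤ j. Then, as an identity of rational numbers, Σ_{k=0}^{j} (−1)^{j−k} · binom(j,k) · (a + 2j − 1) · (a + 2i + 2k)! / ( (i+1)! · (a + i + 2k)! ) equals 2^i · (a + 2i − 1) / (i + 1) if i = j, and equals 0 if i < j. -/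
open Polynomial in
/-- The quotient `(m + i + 2 * k)! / (m + 2 * k)!`, as a polynomial in `k` of degree `i`. -/
noncomputable def factorialQuotient (m i : ℕ) : ℚ[X] :=
  (ascPochhammer ℚ i).comp (C 2 * X + C ((m : ℚ) + 1))

theorem factorialQuotient_eval_natCast (m i k : ℕ) :
    (factorialQuotient m i).eval (k : ℚ) =
      ((m + i + 2 * k).factorial : ℚ) / ((m + 2 * k).factorial : ℚ) := by
  have hne : ((m + 2 * k).factorial : ℚ) ≠ 0 := by positivity
  rw [eq_div_iff hne, factorialQuotient, Polynomial.eval_comp]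
  have hx : Polynomial.eval (k : ℚ) (Polynomial.C 2 * Polynomial.X + Polynomial.C ((m : ℚ) + 1)) =
      ((m + 2 * k + 1 : ℕ) : ℚ) := by
    simp
    ring
  rw [hx, ← ascPochhammer_eval_cast, ascPochhammer_nat_eq_ascFactorial, add_right_comm m i,
    ← Nat.factorial_mul_ascFactorial (m + 2 * k) i]
  push_cast
  ring

theorem factorialQuotient_natDegree (m i : ℕ) : (factorialQuotient m i).natDegree = i := by
  rw [factorialQuotient, Polynomial.natDegree_comp, ascPochhammer_natDegree,
    Polynomial.natDegree_linear two_ne_zero, mul_one]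

theorem factorialQuotient_leadingCoeff (m i : ℕ) :
    (factorialQuotient m i).leadingCoeff = 2 ^ i := by
  have hdeg : (Polynomial.C 2 * Polynomial.X + Polynomial.C ((m : ℚ) + 1)).natDegree ≠ 0 := by
    rw [Polynomial.natDegree_linear two_ne_zero]
    exact one_ne_zero
  rw [factorialQuotient, Polynomial.leadingCoeff_comp hdeg, ascPochhammer_natDegree,
    (monic_ascPochhammer ℚ i).leadingCoeff, Polynomial.leadingCoeff_linear two_ne_zero, one_mul]

theorem fwdDiff_iter_factorialQuotient (m i j : ℕ) (hij : i ≤ j) (x : ℚ) :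
    (fwdDiff 1)^[j] (factorialQuotient m i).eval x =
      if i = j then 2 ^ i * (i.factorial : ℚ) else 0 := by
  split_ifs with h
  · subst h
    have hd := (factorialQuotient m i).fwdDiff_iter_degree_eq_factorial
    rw [factorialQuotient_natDegree, factorialQuotient_leadingCoeff] at hd
    simp [hd]
  · rw [Polynomial.fwdDiff_iter_eq_zero_of_degree_lt
      (by rw [factorialQuotient_natDegree]; exact lt_of_le_of_ne hij h), Pi.zero_apply]


/-- The entries of `M · U` in the proof of Theorem 5 of Krattenthaler: for `i ≤ j`,
the binomial sum equals `2^i (a + 2i - 1)/(i + 1)` when `i = j` and `0` when `i < j`. -/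
theorem stmt_9 (a i j : ℕ) (hij : i ≤ j) :
    (∑ k ∈ Finset.range (j + 1),
      (-1 : ℚ) ^ (j - k) * (j.choose k : ℚ) * ((a : ℚ) + 2 * j - 1) *
        ((a + 2 * i + 2 * k).factorial : ℚ) /
        (((i + 1).factorial : ℚ) * ((a + i + 2 * k).factorial : ℚ))) =
      if i = j then 2 ^ i * ((a : ℚ) + 2 * i - 1) / ((i : ℚ) + 1) else 0 := by
  have hsum := fwdDiff_iter_eq_sum_shift (1 : ℚ) (factorialQuotient (a + i) i).eval j 0
  rw [fwdDiff_iter_factorialQuotient _ _ _ hij] at hsum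
  have hi : ((i + 1).factorial : ℚ) ≠ 0 := by positivity
  trans ((a : ℚ) + 2 * j - 1) / ((i + 1).factorial : ℚ) *
      if i = j then 2 ^ i * (i.factorial : ℚ) else 0
  · rw [hsum, Finset.mul_sum]
    refine Finset.sum_congr rfl fun k _ => ?_
    rw [zero_add, nsmul_one, factorialQuotient_eval_natCast, zsmul_eq_mul, add_assoc a i i,
      ← two_mul]
    push_cast
    field_simp
  · split_ifs with h
    · subst h
      rw [Nat.factorial_succ]
      push_cast
      field_simp
    · exact mul_zero _
end

section
/- Let n ≥ 1 be an integer, let x, ρ, σ be real numbers, and let (a_{i,j})_{i,j≥0} be the doubly indexed sequence of real numbers determined by the initial conditions a_{i,0} = ρ^i and a_{0,i} = σ^i for all i ≥ 0, and the recurrence a_{i,j} = a_{i-1,j} + a_{i,j-1} + x·a_{i-1,j-1} for all i, j ≥ 1. Then for all integers i ≥ 0 and j ≥ 1, a_{i,j} + Σ_{k=0}^{j-1} (−1)^{j−k} ( binom(j−1,k)·σ + binom(j−1,k−1) ) · a_{i,k} = (x + ρ + σ − ρσ) · (1+x)^{j−1} · Σ_{ℓ=0}^{i−1} binom(ℓ,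 j−1) · ρ^{i−ℓ−1}, where binom(j−1,k−1) is interpreted as 0 when k = 0, and the sum over ℓ is empty (hence 0) when i = 0. -/
/-- Coefficient expansion of `(E - 1) ^ m * (E - σ)` (with `E` the shift) applied at `0`. -/
theorem add_sum_range_alternating_choose_eq_fwdDiff_iter (σ : ℝ) (f : ℕ → ℝ) (m : ℕ) :
    f (m + 1) + ∑ k ∈ Finset.range (m + 1), (-1 : ℝ) ^ (m + 1 - k) *
        ((m.choose k : ℝ) * σ + (if k = 0 then 0 else (m.choose (k - 1) : ℝ))) * f k =
      (fwdDiff 1)^[m] (fun k => f (k + 1) - σ * f k) 0 := by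
  have hlast : f (m + 1) = (-1 : ℝ) ^ (m + 1 - (m + 1)) *
      (if m + 1 = 0 then 0 else (m.choose (m + 1 - 1) : ℝ)) * f (m + 1) := by simp
  have hshift : f (m + 1) + ∑ k ∈ Finset.range (m + 1), (-1 : ℝ) ^ (m + 1 - k) *
      (if k = 0 then 0 else (m.choose (k - 1) : ℝ)) * f k =
      ∑ k ∈ Finset.range (m + 1), (-1 : ℝ) ^ (m - k) * (m.choose k : ℝ) * f (k + 1) := by
    conv_lhs => rw [hlast]
    rw [add_comm, ← Finset.sum_range_succ (fun k => (-1 : ℝ) ^ (m + 1 - k) *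
      (if k = 0 then 0 else (m.choose (k - 1) : ℝ)) * f k), Finset.sum_range_succ']
    simp
  rw [fwdDiff_iter_eq_sum_shift]
  simp only [mul_add, add_mul, Finset.sum_add_distrib]
  rw [add_left_comm, hshift, ← Finset.sum_add_distrib]
  refine Finset.sum_congr rfl fun k hk => ?_
  rw [Nat.succ_sub (Finset.mem_range_succ_iff.mp hk)]
  simp
  ring

/-- Pascal-type recurrence for geometrically weighted column sums of binomial coefficients. -/
theorem sum_range_succ_choose_succ_mul_pow {R : Type*} [CommSemiring R] (ρ : R) (i m : ℕ) :
    ∑ l ∈ Finset.range (i + 1), (l.choose (m + 1) : R) * ρ ^ (i + 1 - l - 1) =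
      ∑ l ∈ Finset.range i, (l.choose (m + 1) : R) * ρ ^ (i - l - 1) +
        ∑ l ∈ Finset.range i, (l.choose m : R) * ρ ^ (i - l - 1) := by
  rw [Finset.sum_range_succ', ← Finset.sum_add_distrib]
  simp only [Nat.choose_zero_succ, Nat.cast_zero, zero_mul, add_zero, Nat.add_sub_add_right]
  refine Finset.sum_congr rfl fun l _ => ?_
  rw [Nat.choose_succ_succ]
  push_cast
  ring

/-- The `LU`-factorization claim in the proof of Theorem 1 of Krattenthaler:
for the sequence of Theorem 1, `a i j` plus the alternating binomial combination of
`a i k`, `k < j`, equals `(x+ρ+σ-ρσ)(1+x)^(j-1) Σ_{ℓ<i} C(ℓ, j-1) ρ^(i-ℓ-1)`.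
Here `C(j-1, k-1)` is interpreted as `0` when `k = 0`, and the sum over `ℓ` is empty
when `i = 0`. -/
theorem stmt_10 (n : ℕ) (hn : 1 ≤ n) (x ρ σ : ℝ) (a : ℕ → ℕ → ℝ)
    (ha_row : ∀ i : ℕ, a i 0 = ρ ^ i)
    (ha_col : ∀ i : ℕ, a 0 i = σ ^ i)
    (ha_rec : ∀ i j : ℕ, 1 ≤ i → 1 ≤ j →
      a i j = a (i - 1) j + a i (j - 1) + x * a (i - 1) (j - 1)) :
    ∀ i j : ℕ, 1 ≤ j →
      a i j + ∑ k ∈ Finset.range j, (-1 : ℝ) ^ (j - k) *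
          (((j - 1).choose k : ℝ) * σ +
            (if k = 0 then 0 else ((j - 1).choose (k - 1) : ℝ))) * a i k =
        (x + ρ + σ - ρ * σ) * (1 + x) ^ (j - 1) *
          ∑ ℓ ∈ Finset.range i, (ℓ.choose (j - 1) : ℝ) * ρ ^ (i - ℓ - 1) := by
  intro i j hj
  obtain ⟨m, rfl⟩ := Nat.exists_eq_add_of_le' hj
  simp only [Nat.add_sub_cancel]
  rw [add_sum_range_alternating_choose_eq_fwdDiff_iter σ (a i) m]
  have hrec (i k : ℕ) : a (i + 1) (k + 1) = a i (k + 1) + a (i + 1) k + x * a i k :=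
    ha_rec (i + 1) (k + 1) (by omega) (by omega)
  induction i generalizing m with
  | zero =>
    have hzero : (fun k => a 0 (k + 1) - σ * a 0 k) = fun _ => (0 : ℝ) := by
      ext k
      rw [ha_col, ha_col]
      ring
    rw [hzero, fwdDiff_iter_eq_sum_shift]
    simp
  | succ i ih =>
    cases m with
    | zero =>
      have h := ih 0 (by omega)
      simp only [Function.iterate_zero, id_eq, zero_add, pow_zero, mul_one, Nat.choose_zero_right,
        Nat.cast_one, one_mul] at h ⊢
      rw [Finset.sum_range_succ']
      simp only [Nat.add_sub_add_right, Nat.sub_zero, Nat.add_sub_cancel]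
      have h1 := hrec i 0
      simp only [ha_row, zero_add] at h h1 ⊢
      rw [mul_add, ← h, h1]
      ring
    | succ m =>
      have hdiff : fwdDiff 1 (fun k => a (i + 1) (k + 1) - σ * a (i + 1) k) =
          fwdDiff 1 (fun k => a i (k + 1) - σ * a i k) +
            (1 + x) • (fun k => a i (k + 1) - σ * a i k) := by
        ext k
        simp only [fwdDiff, Pi.add_apply, Pi.smul_apply, smul_eq_mul]
        rw [hrec i (k + 1), hrec i k]
        ring
      rw [Function.iterate_succ_apply, hdiff, fwdDiff_iter_add, fwdDiff_iter_const_smul,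
        ← Function.iterate_succ_apply, Nat.succ_eq_add_one, Pi.add_apply, Pi.smul_apply,
        ih _ (by omega), ih _ (by omega), sum_range_succ_choose_succ_mul_pow, smul_eq_mul]
      ring
end

section
/- Let n ≥ 1 be an integer, let a be an integer with 0 ≤ a ≤ n−1, let j be an integer with 0 ≤ j ≤ 2n−1, and let Y be a real number such that (Y/2 + 2a − i)_i ≠ 0 for every integer i with 0 ≤ i ≤ a. Then Σ_{i=0}^{a} (−1)^i · binom(a,i) · ( (Y + 2n + 2a − i)_i / (Y/2 + 2a − i)_i ) · (2a − i − j) · (−i)_j · (Y + 2a − i + j + 1)_{2n−j−1} = 0. -/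
theorem descPochhammer_eval_add {R : Type*} [CommRing R] (m k : ℕ) (x : R) :
    (descPochhammer R (m + k)).eval x =
      (descPochhammer R m).eval x * (descPochhammer R k).eval (x - m) := by
  rw [← descPochhammer_mul]
  simp

/-- The Chu-Vandermonde summation in a form without denominators. -/
theorem sum_choose_mul_descPochhammer_eval {R : Type*} [CommRing R] (N : ℕ) (A C : R) :
    ∑ k ∈ Finset.range (N + 1), (-1) ^ k * (N.choose k : R) * (descPochhammer R k).eval A *
      (descPochhammer R (N - k)).eval (C - k) = (descPochhammer R N).eval (C - A) := by
  induction N generalizing A C with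
  | zero => simp
  | succ N ih =>
    have hpascal : ∀ k ∈ Finset.range (N + 1),
        (-1) ^ (k + 1) * ((N + 1).choose (k + 1) : R) * (descPochhammer R (k + 1)).eval A *
          (descPochhammer R (N + 1 - (k + 1))).eval (C - (k + 1 : ℕ)) =
        (-1) ^ (k + 1) * (N.choose (k + 1) : R) * (descPochhammer R (k + 1)).eval A *
          (descPochhammer R (N - k)).eval (C - (k + 1 : ℕ)) +
        -A * ((-1) ^ k * (N.choose k : R) * (descPochhammer R k).eval (A - 1) *
          (descPochhammer R (N - k)).eval (C - 1 - k)) := by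
      intro k _
      have h1 : (descPochhammer R (k + 1)).eval A = A * (descPochhammer R k).eval (A - 1) := by
        rw [add_comm, descPochhammer_eval_add]; simp
      have h2 : C - ((k + 1 : ℕ) : R) = C - 1 - k := by push_cast; ring
      rw [Nat.choose_succ_succ, h1, h2, Nat.add_sub_add_right]
      push_cast
      ring
    have hleft : ∀ k ∈ Finset.range (N + 1),
        (-1) ^ k * (N.choose k : R) * (descPochhammer R k).eval A *
          (descPochhammer R (N + 1 - k)).eval (C - k) =
        (C - N) * ((-1) ^ k * (N.choose k : R) * (descPochhammer R k).eval A *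
          (descPochhammer R (N - k)).eval (C - k)) := by
      intro k hk
      obtain ⟨m, rfl⟩ := Nat.exists_eq_add_of_le (Finset.mem_range_succ_iff.1 hk)
      rw [add_assoc, Nat.add_sub_cancel_left, Nat.add_sub_cancel_left, descPochhammer_eval_add]
      simp
      ring
    have hshift := Finset.sum_range_succ' (fun k ↦ (-1) ^ k * (N.choose k : R) *
      (descPochhammer R k).eval A * (descPochhammer R (N + 1 - k)).eval (C - k)) (N + 1)
    rw [Finset.sum_range_succ, Finset.sum_congr rfl hleft, ← Finset.mul_sum, ih] at hshift
    simp only [Nat.choose_succ_self, Nat.add_sub_add_right] at hshift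
    rw [Finset.sum_range_succ', Finset.sum_congr rfl hpascal, Finset.sum_add_distrib,
      ← Finset.mul_sum, ih, descPochhammer_succ_eval]
    simp only [Nat.choose_zero_right] at hshift ⊢
    rw [show C - 1 - (A - 1) = C - A by ring]
    linear_combination -hshift

theorem sum_choose_mul_two_mul_sub_mul_descPochhammer_eval {R : Type*} [CommRing R] (N : ℕ)
    (A C : R) (hA : A = 2 * (C + 1 - N)) :
    ∑ k ∈ Finset.range (N + 1), (-1) ^ k * (N.choose k : R) * (2 * N - k) *
      (descPochhammer R k).eval A * (descPochhammer R (N - k)).eval (C - k) = 0 := by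
  cases N with
  | zero => simp
  | succ N =>
    have hsplit : ∀ k ∈ Finset.range (N + 1 + 1),
        (-1) ^ k * ((N + 1).choose k : R) * (2 * (N + 1 : ℕ) - k) *
          (descPochhammer R k).eval A * (descPochhammer R (N + 1 - k)).eval (C - k) =
        2 * (N + 1 : ℕ) * ((-1) ^ k * ((N + 1).choose k : R) *
          (descPochhammer R k).eval A * (descPochhammer R (N + 1 - k)).eval (C - k)) -
        k * ((-1) ^ k * ((N + 1).choose k : R) *
          (descPochhammer R k).eval A * (descPochhammer R (N + 1 - k)).eval (C - k)) := by
      intro k _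
      ring
    have hweight : ∀ k ∈ Finset.range (N + 1),
        ((k + 1 : ℕ) : R) * ((-1) ^ (k + 1) * ((N + 1).choose (k + 1) : R) *
          (descPochhammer R (k + 1)).eval A *
          (descPochhammer R (N + 1 - (k + 1))).eval (C - (k + 1 : ℕ))) =
        -((N + 1) * A) * ((-1) ^ k * (N.choose k : R) * (descPochhammer R k).eval (A - 1) *
          (descPochhammer R (N - k)).eval (C - 1 - k)) := by
      intro k _
      have h1 : (descPochhammer R (k + 1)).eval A = A * (descPochhammer R k).eval (A - 1) := by
        rw [add_comm, descPochhammer_eval_add]; simp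
      have h2 : C - ((k + 1 : ℕ) : R) = C - 1 - k := by push_cast; ring
      have h3 := congrArg (Nat.cast (R := R)) (Nat.add_one_mul_choose_eq N k)
      push_cast at h3
      rw [h1, h2, Nat.add_sub_add_right]
      push_cast
      linear_combination (-1) ^ k * A * (descPochhammer R k).eval (A - 1) *
        (descPochhammer R (N - k)).eval (C - 1 - k) * h3
    rw [Finset.sum_congr rfl hsplit, Finset.sum_sub_distrib, ← Finset.mul_sum,
      sum_choose_mul_descPochhammer_eval, Finset.sum_range_succ', Finset.sum_congr rfl hweight,
      ← Finset.mul_sum, sum_choose_mul_descPochhammer_eval, descPochhammer_succ_eval,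
      show C - 1 - (A - 1) = C - A by ring]
    push_cast at hA ⊢
    linear_combination -(N + 1) * (descPochhammer R N).eval (C - A) * hA

theorem ascPochhammer_eval_neg_natCast {R : Type*} [CommRing R] (i j : ℕ) :
    (ascPochhammer R j).eval (-(i : R)) = (-1) ^ j * (i.descFactorial j : R) := by
  rw [ascPochhammer_eval_neg_eq_descPochhammer, descPochhammer_eval_eq_descFactorial]

/-- Step 1 in the proof of Theorem 6 of Krattenthaler: the linear dependence of the rows
of `T_n(-2a-1, Y)`; here `(α)_m` is the Pochhammer symbol (rising factorial). -/
theorem stmt_11 (n : ℕ) (hn : 1 ≤ n) (a : ℕ) (ha : a ≤ n - 1)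
    (j : ℕ) (hj : j ≤ 2 * n - 1) (Y : ℝ)
    (hY : ∀ i : ℕ, i ≤ a → (ascPochhammer ℝ i).eval (Y / 2 + 2 * a - i) ≠ 0) :
    ∑ i ∈ Finset.range (a + 1),
      (-1 : ℝ) ^ i * (a.choose i : ℝ) *
        ((ascPochhammer ℝ i).eval (Y + 2 * n + 2 * a - i) /
          (ascPochhammer ℝ i).eval (Y / 2 + 2 * a - i)) *
        (2 * (a : ℝ) - i - j) * (ascPochhammer ℝ j).eval (-(i : ℝ)) *
        (ascPochhammer ℝ (2 * n - j - 1)).eval (Y + 2 * a - i + j + 1) = 0 := by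
  have hden : ∀ i : ℕ, (ascPochhammer ℝ i).eval (Y / 2 + 2 * a - i) =
      (descPochhammer ℝ i).eval (Y / 2 + 2 * a - 1) := by
    intro i
    rw [descPochhammer_eval_eq_ascPochhammer]
    congr 1
    ring
  rcases lt_or_ge a j with haj | haj
  · refine Finset.sum_eq_zero fun i hi ↦ ?_
    have hij : i < j := by have := Finset.mem_range.1 hi; omega
    rw [ascPochhammer_eval_neg_natCast, Nat.descFactorial_of_lt hij]
    simp
  obtain ⟨N, rfl⟩ := Nat.exists_eq_add_of_le haj
  obtain ⟨p, hp⟩ := Nat.exists_eq_add_of_le hj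
  have hpn : (2 * n : ℝ) = j + p + 1 := by
    have : 2 * n = j + p + 1 := by omega
    exact_mod_cast this
  rw [add_assoc j N 1, Finset.sum_range_add, Finset.sum_eq_zero, zero_add]
  swap
  · intro i hi
    rw [ascPochhammer_eval_neg_natCast, Nat.descFactorial_of_lt (Finset.mem_range.1 hi)]
    simp
  set W : ℝ := Y / 2 + 2 * (j + N : ℕ) - 1 with hW
  set A : ℝ := Y + 2 * (j + N : ℕ) with hA
  set Z : ℝ := Y + 2 * n + 2 * (j + N : ℕ) - 1 with hZ
  have hterm : ∀ k ∈ Finset.range (N + 1),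
      (-1 : ℝ) ^ (j + k) * ((j + N).choose (j + k) : ℝ) *
        ((ascPochhammer ℝ (j + k)).eval (Y + 2 * n + 2 * (j + N : ℕ) - (j + k : ℕ)) /
          (ascPochhammer ℝ (j + k)).eval (Y / 2 + 2 * (j + N : ℕ) - (j + k : ℕ))) *
        (2 * ((j + N : ℕ) : ℝ) - (j + k : ℕ) - j) *
        (ascPochhammer ℝ j).eval (-((j + k : ℕ) : ℝ)) *
        (ascPochhammer ℝ (2 * n - j - 1)).eval (A - (j + k : ℕ) + j + 1) =
      ((j + N).descFactorial j * (descPochhammer ℝ (j + p)).eval Z /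
        (descPochhammer ℝ (j + N)).eval W) *
      ((-1) ^ k * (N.choose k : ℝ) * (2 * N - k) *
        (descPochhammer ℝ k).eval A * (descPochhammer ℝ (N - k)).eval (W - j - k)) := by
    intro k hk
    have hkN := Finset.mem_range_succ_iff.1 hk
    have hk0 := hY (j + k) (by omega)
    have hN0 := hY (j + N) le_rfl
    rw [hden] at hk0 hN0
    have hnum : (ascPochhammer ℝ (j + k)).eval (Y + 2 * n + 2 * (j + N : ℕ) - (j + k : ℕ)) =
        (descPochhammer ℝ (j + k)).eval Z := by
      rw [descPochhammer_eval_eq_ascPochhammer]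
      congr 1
      rw [hZ]; ring
    have hlast : (ascPochhammer ℝ (2 * n - j - 1)).eval (A - (j + k : ℕ) + j + 1) =
        (descPochhammer ℝ p).eval (Z - (j + k : ℕ)) := by
      rw [descPochhammer_eval_eq_ascPochhammer, show 2 * n - j - 1 = p by omega]
      congr 1
      rw [hZ, hA, hpn]; ring
    have hprod : (descPochhammer ℝ (j + k)).eval Z * (descPochhammer ℝ p).eval (Z - (j + k : ℕ)) =
        (descPochhammer ℝ (j + p)).eval Z * (descPochhammer ℝ k).eval A := by
      rw [← descPochhammer_eval_add, show j + k + p = j + p + k by ring, descPochhammer_eval_add]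
      congr 2
      rw [hZ, hA, hpn]; push_cast; ring
    have hquot : (descPochhammer ℝ (j + N)).eval W =
        (descPochhammer ℝ (j + k)).eval W * (descPochhammer ℝ (N - k)).eval (W - j - k) := by
      rw [show j + N = j + k + (N - k) by omega, descPochhammer_eval_add,
        show W - ((j + k : ℕ) : ℝ) = W - j - k by push_cast; ring]
    have hchoose : ((j + N).choose (j + k) : ℝ) * ((j + k).descFactorial j : ℝ) =
        (j + N).descFactorial j * N.choose k := by
      have h := Nat.choose_mul (n := j + N) (k := j + k) (s := j) (by omega)
      rw [Nat.add_sub_cancel_left, Nat.add_sub_cancel_left] at h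
      rw [Nat.descFactorial_eq_factorial_mul_choose, Nat.descFactorial_eq_factorial_mul_choose]
      exact_mod_cast (by linear_combination j.factorial * h :
        (j + N).choose (j + k) * (j.factorial * (j + k).choose j) =
          j.factorial * (j + N).choose j * N.choose k)
    have hsign : (-1 : ℝ) ^ (j + k) * (-1) ^ j = (-1) ^ k := by
      rw [pow_add, mul_right_comm, ← mul_pow]; simp
    rw [hnum, hden, hlast, ascPochhammer_eval_neg_natCast]
    calc
      _ = ((-1 : ℝ) ^ (j + k) * (-1) ^ j) *
          (((j + N).choose (j + k) : ℝ) * ((j + k).descFactorial j : ℝ)) *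
          ((descPochhammer ℝ (j + k)).eval Z * (descPochhammer ℝ p).eval (Z - (j + k : ℕ))) *
          (2 * N - k) / (descPochhammer ℝ (j + k)).eval W := by push_cast; ring
      _ = _ := by
        rw [hsign, hchoose, hprod]
        field_simp
        rw [hquot]
        ring
  rw [Finset.sum_congr rfl hterm, ← Finset.mul_sum,
    sum_choose_mul_two_mul_sub_mul_descPochhammer_eval, mul_zero]
  rw [hA, hW]
  push_cast
  ring
end

section
/- Let n ≥ 1 be an integer, let a be an integer with 0 ≤ a ≤ n−1, let j be an integer with 0 ≤ j ≤ 2n−1, and let X be a real number such that (X + 2n − a − i)_i ≠ 0 for every integer i with 0 ≤ i ≤ a. Then Σ_{i=0}^{a} (−1)^i · binom(a,i) · ( (X/2 + 2n − a − i + 1/2)_i / (X + 2n − a − i)_i ) · (2n − a − i − j − 1) · (X + 2n − a − i)_j · (a − 2n − i + j + 2)_{2n−j−1} = 0. -/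
open Finset in
/-- The Chu-Vandermonde identity for rising factorials. -/
theorem ascPochhammer_eval_add (x y : ℝ) (n : ℕ) :
    (ascPochhammer ℝ n).eval (x + y) = ∑ ij ∈ antidiagonal n, (n.choose ij.1 : ℝ) *
      ((ascPochhammer ℝ ij.1).eval x * (ascPochhammer ℝ ij.2).eval y) := by
  induction n with
  | zero => simp
  | succ k ih =>
    rw [sum_antidiagonal_choose_succ_mul
      fun i j => (ascPochhammer ℝ i).eval x * (ascPochhammer ℝ j).eval y,
      ← sum_add_distrib, ascPochhammer_succ_eval, ih, sum_mul]
    refine sum_congr rfl fun ij hij => ?_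
    have hk : (k : ℝ) = ij.1 + ij.2 := by exact_mod_cast (mem_antidiagonal.mp hij).symm
    have hc : k.choose ij.2 = k.choose ij.1 :=
      (Nat.choose_symm_of_eq_add (mem_antidiagonal.mp hij).symm).symm
    rw [ascPochhammer_succ_eval, ascPochhammer_succ_eval, hc, hk]
    ring

theorem ascPochhammer_succ_eval_left (n : ℕ) (x : ℝ) :
    (ascPochhammer ℝ (n + 1)).eval x = x * (ascPochhammer ℝ n).eval (x + 1) := by
  simp [ascPochhammer_succ_left]

theorem ascPochhammer_add_eval (n m : ℕ) (x : ℝ) :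
    (ascPochhammer ℝ (n + m)).eval x =
      (ascPochhammer ℝ n).eval x * (ascPochhammer ℝ m).eval (x + n) := by
  simp [← ascPochhammer_mul]

theorem ascPochhammer_eval_reflect (n : ℕ) (x : ℝ) :
    (-1) ^ n * (ascPochhammer ℝ n).eval (x - n + 1) = (ascPochhammer ℝ n).eval (-x) := by
  rw [ascPochhammer_eval_neg_eq_descPochhammer, descPochhammer_eval_eq_ascPochhammer]

open Finset in
theorem sum_choose_mul_add_mul_ascPochhammer (m : ℕ) (e : ℝ) :
    ∑ ij ∈ antidiagonal (m + 1), ((m + 1).choose ij.1 : ℝ) * (m + 1 + ij.1) *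
      ((ascPochhammer ℝ ij.1).eval (-e) * (ascPochhammer ℝ ij.2).eval (2 * e)) = 0 := by
  have h₁ := ascPochhammer_eval_add (-e) (2 * e) (m + 1)
  have h₂ : ∑ ij ∈ antidiagonal (m + 1), ((m + 1).choose ij.1 : ℝ) * ij.1 *
      ((ascPochhammer ℝ ij.1).eval (-e) * (ascPochhammer ℝ ij.2).eval (2 * e)) =
      (m + 1) * -e * (ascPochhammer ℝ m).eval (-e + 1 + 2 * e) := by
    rw [Nat.sum_antidiagonal_succ, ascPochhammer_eval_add, mul_sum]
    simp only [Nat.cast_zero, mul_zero, zero_mul, zero_add]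
    refine sum_congr rfl fun ij _ => ?_
    have hc : ((m + 1 : ℕ) : ℝ) * m.choose ij.1 = (m + 1).choose (ij.1 + 1) * (ij.1 + 1 : ℕ) := by
      exact_mod_cast Nat.add_one_mul_choose_eq m ij.1
    rw [ascPochhammer_succ_eval_left, ← hc]
    push_cast
    ring
  have h₃ := ascPochhammer_succ_eval_left m e
  rw [show -e + 2 * e = e by ring] at h₁
  rw [show -e + 1 + 2 * e = e + 1 by ring] at h₂
  calc _ = (m + 1) * ∑ ij ∈ antidiagonal (m + 1), ((m + 1).choose ij.1 : ℝ) *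
        ((ascPochhammer ℝ ij.1).eval (-e) * (ascPochhammer ℝ ij.2).eval (2 * e)) +
        ∑ ij ∈ antidiagonal (m + 1), ((m + 1).choose ij.1 : ℝ) * ij.1 *
        ((ascPochhammer ℝ ij.1).eval (-e) * (ascPochhammer ℝ ij.2).eval (2 * e)) := by
        rw [mul_sum, ← sum_add_distrib]
        exact sum_congr rfl fun _ _ => by ring
    _ = 0 := by rw [← h₁, h₂, h₃]; ring

theorem choose_mul_ascPochhammer_eval (i q l : ℕ) :
    ((i + q + l).choose i : ℝ) * (ascPochhammer ℝ l).eval (q + 1 : ℝ) =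
      (i + q + l).factorial / (i + q).factorial * (i + q).choose i := by
  have h := factorial_mul_ascPochhammer ℝ q l
  have h₁ : ((i + q).choose i * i.factorial * q.factorial : ℝ) = (i + q).factorial := by
    rw [Nat.choose_symm_add]
    exact_mod_cast Nat.add_choose_mul_factorial_mul_factorial i q
  have h₂ : ((i + (q + l)).choose i * i.factorial * (q + l).factorial : ℝ) =
      (i + (q + l)).factorial := by
    rw [Nat.choose_symm_add]
    exact_mod_cast Nat.add_choose_mul_factorial_mul_factorial i (q + l)
  have hi : (i.factorial : ℝ) ≠ 0 := by positivity
  have hq : (q.factorial : ℝ) ≠ 0 := by positivity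
  have hc : ((i + q).choose i : ℝ) ≠ 0 := by
    exact_mod_cast (Nat.choose_pos (Nat.le_add_right i q)).ne'
  rw [add_assoc, ← h₁, ← h₂, ← h]
  field_simp

theorem summand_eq (i q l N : ℕ) (X : ℝ)
    (hX : (ascPochhammer ℝ i).eval (X + N + 1 - i) ≠ 0) :
    (-1 : ℝ) ^ i * ((i + q + l).choose i : ℝ) *
        ((ascPochhammer ℝ i).eval ((X + 2 * N + 1) / 2 - i + 1) /
          (ascPochhammer ℝ i).eval (X + N + 1 - i)) *
        -(i + q + i) *
        (ascPochhammer ℝ (i + (N + q))).eval (X + N + 1 - i) *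
        (ascPochhammer ℝ l).eval (q + 1 : ℝ) =
      -((i + q + l).factorial / (i + q).factorial * (ascPochhammer ℝ N).eval (X + N + 1)) *
        (((i + q).choose i : ℝ) * (i + q + i) *
          ((ascPochhammer ℝ i).eval (-((X + 2 * N + 1) / 2)) *
            (ascPochhammer ℝ q).eval (2 * ((X + 2 * N + 1) / 2)))) := by
  rw [ascPochhammer_add_eval i, ascPochhammer_add_eval N, sub_add_cancel,
    ← ascPochhammer_eval_reflect i,
    show X + N + 1 + N = 2 * ((X + 2 * N + 1) / 2) by ring]
  have h := choose_mul_ascPochhammer_eval i q l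
  generalize (ascPochhammer ℝ i).eval (X + N + 1 - i) = p at hX ⊢
  calc _ = (((i + q + l).choose i : ℝ) * (ascPochhammer ℝ l).eval (q + 1 : ℝ)) *
        ((-1 : ℝ) ^ i * (ascPochhammer ℝ i).eval ((X + 2 * N + 1) / 2 - i + 1) * -(i + q + i) *
          (ascPochhammer ℝ N).eval (X + N + 1) *
          (ascPochhammer ℝ q).eval (2 * ((X + 2 * N + 1) / 2))) := by
        field_simp
    _ = _ := by rw [h]; ring

/-- Step 2 in the proof of Theorem 6 of Krattenthaler: the linear dependence of the rows
of `T_n(X, -4n+2a+2)`; here `(α)_m` is the Pochhammer symbol (rising factorial). -/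
theorem stmt_12 (n : ℕ) (hn : 1 ≤ n) (a : ℕ) (ha : a ≤ n - 1)
    (j : ℕ) (hj : j ≤ 2 * n - 1) (X : ℝ)
    (hX : ∀ i : ℕ, i ≤ a → (ascPochhammer ℝ i).eval (X + 2 * n - a - i) ≠ 0) :
    ∑ i ∈ Finset.range (a + 1),
      (-1 : ℝ) ^ i * (a.choose i : ℝ) *
        ((ascPochhammer ℝ i).eval (X / 2 + 2 * n - a - i + 1 / 2) /
          (ascPochhammer ℝ i).eval (X + 2 * n - a - i)) *
        (2 * (n : ℝ) - a - i - j - 1) *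
        (ascPochhammer ℝ j).eval (X + 2 * n - a - i) *
        (ascPochhammer ℝ (2 * n - j - 1)).eval ((a : ℝ) - 2 * n - i + j + 2) = 0 := by
  obtain ⟨N, hN⟩ : ∃ N, 2 * n = N + 1 + a := ⟨2 * n - a - 1, by omega⟩
  have hNR : (2 * n : ℝ) = N + 1 + a := by exact_mod_cast hN
  have vanish : ∀ i ≤ a, j + 2 ≤ N + 1 + i →
      (ascPochhammer ℝ (2 * n - j - 1)).eval ((a : ℝ) - 2 * n - i + j + 2) = 0 := by
    intro i hi hij
    obtain ⟨k, hk⟩ := Nat.exists_eq_add_of_le hij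
    have hkR : (N + 1 + i : ℝ) = j + 2 + k := by exact_mod_cast hk
    rw [show (a : ℝ) - 2 * n - i + j + 2 = -k by rw [hNR]; linear_combination -hkR]
    exact ascPochhammer_eval_neg_coe_nat_of_lt (by omega)
  rcases Nat.lt_or_ge N j with hNj | hNj
  · obtain ⟨m, rfl⟩ := Nat.exists_eq_add_of_lt hNj
    obtain ⟨l, rfl⟩ : ∃ l, a = m + 1 + l := ⟨a - (m + 1), by omega⟩
    rw [← Finset.sum_subset (Finset.range_mono (show m + 2 ≤ m + 1 + l + 1 by omega))
      fun i hi hi' => ?_]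
    swap
    · simp only [Finset.mem_range] at hi hi'
      rw [vanish i (by omega) (by omega), mul_zero]
    rw [← mul_zero (-((m + 1 + l).factorial / (m + 1).factorial *
        (ascPochhammer ℝ N).eval (X + N + 1)) : ℝ),
      ← sum_choose_mul_add_mul_ascPochhammer m ((X + 2 * N + 1) / 2),
      Finset.Nat.sum_antidiagonal_eq_sum_range_succ_mk, Finset.mul_sum]
    refine Finset.sum_congr rfl fun i hi => ?_
    obtain ⟨q, hq⟩ := Nat.exists_eq_add_of_le (Nat.lt_succ_iff.mp (Finset.mem_range.mp hi))
    have hqR : (m + 1 : ℝ) = i + q := by exact_mod_cast hq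
    have hXi := hX i (by omega)
    push_cast at hNR
    rw [show X + 2 * n - (m + 1 + l : ℕ) - i = X + N + 1 - i by rw [hNR]; push_cast; ring] at hXi ⊢
    have h := summand_eq i q l N X hXi
    rw [show X / 2 + 2 * n - (m + 1 + l : ℕ) - i + 1 / 2 = (X + 2 * N + 1) / 2 - i + 1 by
        rw [hNR]; push_cast; ring,
      show 2 * (n : ℝ) - (m + 1 + l : ℕ) - i - (N + m + 1 : ℕ) - 1 = -(i + q + i) by
        rw [hNR]; push_cast; linear_combination -hqR,
      show ((m + 1 + l : ℕ) : ℝ) - 2 * n - i + (N + m + 1 : ℕ) + 2 = q + 1 by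
        rw [hNR]; push_cast; linear_combination hqR,
      show 2 * n - (N + m + 1) - 1 = l by omega, show N + m + 1 = i + (N + q) by omega,
      hqR, hq, Nat.add_sub_cancel_left, h]
  · refine Finset.sum_eq_zero fun i hi => ?_
    have hi' := Finset.mem_range.mp hi
    by_cases h : j + 2 ≤ N + 1 + i
    · rw [vanish i (by omega) h, mul_zero]
    · obtain rfl : i = 0 := by omega
      obtain rfl : j = N := by omega
      rw [show 2 * (n : ℝ) - a - (0 : ℕ) - j - 1 = 0 by rw [hNR]; push_cast; ring]
      ring
end

section
/- Let n ≥ 1 be an integer, let a be an integer with 0 ≤ a ≤ n−1, let v be an integer with 0 ≤ v ≤ 2n−2a−4, let j be an integer with 0 ≤ j ≤ 2n−1, and let X be a real number such that (X + 2a + v − i + 4)_i ≠ 0 for every integer i with 0 ≤ i ≤ 2a+3. Then Σ_{i=0}^{2a+3} (−1)^i · binom(2a+3, i) · ( (X + 2n + v − i + 2)_i / (X + 2a + v − i + 4)_i ) · (2a + v − i − j + 3) · (X + 2a + v − i + 4)_j · (X + v − i + j + 3)_{2n−j−1} = 0. -/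
lemma ascPochhammer_eval_add_s14 (x : ℝ) (p q : ℕ) :
    (ascPochhammer ℝ (p + q)).eval x =
      (ascPochhammer ℝ p).eval x * (ascPochhammer ℝ q).eval (x + p) := by
  simp [← ascPochhammer_mul]

/-- Two ways of multiplying overlapping rising factorials whose lengths have equal sums. -/
lemma ascPochhammer_eval_mul_exchange (x y : ℝ) {p q r s : ℕ} (h : p + s = q + r)
    (hxy : y + r = x + p) :
    (ascPochhammer ℝ p).eval x * (ascPochhammer ℝ s).eval y =
      (ascPochhammer ℝ q).eval x * (ascPochhammer ℝ r).eval y := by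
  rcases le_total p q with hpq | hqp
  · obtain ⟨d, rfl⟩ := Nat.exists_eq_add_of_le hpq
    obtain rfl : s = r + d := by omega
    rw [ascPochhammer_eval_add_s14, ascPochhammer_eval_add_s14, hxy]
    ring
  · obtain ⟨d, rfl⟩ := Nat.exists_eq_add_of_le hqp
    obtain rfl : r = s + d := by omega
    have hs : y + s = x + q := by push_cast at hxy; linarith
    rw [ascPochhammer_eval_add_s14, ascPochhammer_eval_add_s14, hs]
    ring

/-- The alternating binomial sum of length `m` annihilates polynomials of degree below `m`. -/
lemma sum_neg_one_pow_mul_choose_mul_eval_eq_zero {m : ℕ} {P : Polynomial ℝ}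
    (hP : P.natDegree < m) :
    ∑ i ∈ Finset.range (m + 1), (-1 : ℝ) ^ i * (m.choose i : ℝ) * P.eval (i : ℝ) = 0 := by
  have h := congrFun (Polynomial.fwdDiff_iter_eq_zero_of_degree_lt hP) 0
  rw [fwdDiff_iter_eq_sum_shift] at h
  have key : ∑ i ∈ Finset.range (m + 1), (-1 : ℝ) ^ i * (m.choose i : ℝ) * P.eval (i : ℝ) =
      (-1 : ℝ) ^ m * ∑ i ∈ Finset.range (m + 1),
        ((-1 : ℤ) ^ (m - i) * m.choose i) • P.eval (0 + i • (1 : ℝ)) := by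
    rw [Finset.mul_sum]
    refine Finset.sum_congr rfl fun i hi ↦ ?_
    obtain ⟨d, rfl⟩ := Nat.exists_eq_add_of_le (Nat.lt_succ_iff.mp (Finset.mem_range.mp hi))
    have hd : (-1 : ℝ) ^ d * (-1) ^ d = 1 := by rw [← mul_pow]; simp
    simp only [zsmul_eq_mul, nsmul_eq_mul, mul_one, zero_add, Nat.add_sub_cancel_left]
    push_cast
    rw [pow_add]
    linear_combination (-(-1 : ℝ) ^ i * ((i + d).choose i : ℝ) * P.eval (i : ℝ)) * hd
  rw [key, h]
  simp

/-- Step 4 in the proof of Theorem 6 of Krattenthaler: the linear dependence of the rows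
of `T_n(X, X-2a-1)`; here `(α)_m` is the Pochhammer symbol (rising factorial). -/
theorem stmt_14 (n : ℕ) (hn : 1 ≤ n) (a : ℕ) (ha : a ≤ n - 1)
    (v : ℕ) (hv : (v : ℤ) ≤ 2 * n - 2 * a - 4)
    (j : ℕ) (hj : j ≤ 2 * n - 1) (X : ℝ)
    (hX : ∀ i : ℕ, i ≤ 2 * a + 3 →
      (ascPochhammer ℝ i).eval (X + 2 * a + v - i + 4) ≠ 0) :
    ∑ i ∈ Finset.range (2 * a + 4),
      (-1 : ℝ) ^ i * ((2 * a + 3).choose i : ℝ) *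
        ((ascPochhammer ℝ i).eval (X + 2 * n + v - i + 2) /
          (ascPochhammer ℝ i).eval (X + 2 * a + v - i + 4)) *
        (2 * (a : ℝ) + v - i - j + 3) *
        (ascPochhammer ℝ j).eval (X + 2 * a + v - i + 4) *
        (ascPochhammer ℝ (2 * n - j - 1)).eval (X + v - i + j + 3) = 0 := by
  obtain ⟨b, rfl⟩ : ∃ b, n = a + 1 + b := Nat.exists_eq_add_of_le (by omega)
  set P : Polynomial ℝ :=
    (Polynomial.C (2 * (a : ℝ) + v - j + 3) - Polynomial.X) *
      (ascPochhammer ℝ (2 * a + 1)).comp (Polynomial.C (X + v + j + 3) - Polynomial.X) with hPdef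
  have hlin (c : ℝ) : (Polynomial.C c - Polynomial.X).natDegree ≤ 1 := by compute_degree
  have hP : P.natDegree < 2 * a + 3 := by
    have h1 := hlin (2 * (a : ℝ) + v - j + 3)
    have h2 : ((ascPochhammer ℝ (2 * a + 1)).comp
        (Polynomial.C (X + v + j + 3) - Polynomial.X)).natDegree ≤ 2 * a + 1 := by
      rw [Polynomial.natDegree_comp, ascPochhammer_natDegree]
      exact (Nat.mul_le_mul_left _ (hlin _)).trans_eq (mul_one _)
    exact (Polynomial.natDegree_mul_le_of_le h1 h2).trans_lt (by omega)
  rw [← mul_zero ((ascPochhammer ℝ (2 * b)).eval (X + 2 * a + v + 4)),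
    ← sum_neg_one_pow_mul_choose_mul_eval_eq_zero hP, Finset.mul_sum]
  refine Finset.sum_congr rfl fun i hi ↦ ?_
  have hne := hX i (Nat.lt_succ_iff.mp (Finset.mem_range.mp hi))
  have hjoin : (ascPochhammer ℝ (2 * (a + 1 + b) - j - 1)).eval (X + v - i + j + 3) *
      (ascPochhammer ℝ i).eval (X + 2 * ((a + 1 + b : ℕ) : ℝ) + v - i + 2) =
      (ascPochhammer ℝ (2 * (a + 1 + b) - j - 1 + i)).eval (X + v - i + j + 3) := by
    rw [ascPochhammer_eval_add_s14, Nat.cast_sub (by omega), Nat.cast_sub (by omega)]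
    congr 2
    push_cast
    ring
  have hsplit : (ascPochhammer ℝ (i + 2 * b)).eval (X + 2 * a + v - i + 4) =
      (ascPochhammer ℝ i).eval (X + 2 * a + v - i + 4) *
        (ascPochhammer ℝ (2 * b)).eval (X + 2 * a + v + 4) := by
    rw [ascPochhammer_eval_add_s14]
    congr 2
    ring
  have hexch := ascPochhammer_eval_mul_exchange (X + 2 * a + v - i + 4) (X + v - i + j + 3)
    (p := j) (q := i + 2 * b) (r := 2 * a + 1) (s := 2 * (a + 1 + b) - j - 1 + i)
    (by omega) (by push_cast; ring)
  rw [hsplit, ← hjoin] at hexch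
  have hPi : P.eval (i : ℝ) = (2 * (a : ℝ) + v - i - j + 3) *
      (ascPochhammer ℝ (2 * a + 1)).eval (X + v - i + j + 3) := by
    simp only [hPdef, Polynomial.eval_mul, Polynomial.eval_comp, Polynomial.eval_sub,
      Polynomial.eval_C, Polynomial.eval_X]
    ring_nf
  rw [hPi]
  field_simp
  linear_combination ((2 * a + 3).choose i : ℝ) * (2 * (a : ℝ) + v - i - j + 3) * hexch
end
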